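/- arXiv:1904.00989 — 3 statements merged into one kernel-verified Lean document; each statement's English description precedes it below -/
import Mathlib

section
/- Local sensitivity equals twice the second moment of the influence function, implicit-dependence case (Theorem 6): under χ²-divergence, Assumptions Φ(ii), M(i) and M(iv), and the GMM-type regularity conditions listed, the local sensitivity limit s = lim_{δ↓0} (κ̄(N_δ) − κ̲(N_δ))²/(4δ) exists and equals 2 E^{F*}[ι(U)²], where ι(u) = −J(H'V⁻¹H)⁻¹H'V⁻¹h₀(u). -/
open MeasureTheory Filter Set
open scoped ENNReal Pointwise Classical

noncomputable section

namespace CFSens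

/-- map an extended real to `ℝ≥0∞` (negatives go to `0`; only used on nonnegative values). -/
def erealToENNReal (x : EReal) : ℝ≥0∞ := if x = ⊤ then ⊤ else ENNReal.ofReal x.toReal

/-- Euclidean dot product. -/
def dot {ι : Type*} [Fintype ι] (a b : ι → ℝ) : ℝ := ∑ i, a i * b i

/-- Convex conjugate `φ*(x) = sup_{t ≥ 0} (t x - φ t)` (`EReal`-valued). -/
def phiStar (φ : ℝ → ℝ) (x : ℝ) : EReal :=
  ⨆ t ∈ Set.Ici (0:ℝ), ((t * x - φ t : ℝ) : EReal)

/-- Convex conjugate `(ηφ)*(x) = sup_{t ≥ 0} (t x - η φ t)` of `ηφ`, for `η ≥ 0`. -/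
def etaPhiStar (φ : ℝ → ℝ) (η x : ℝ) : EReal :=
  ⨆ t ∈ Set.Ici (0:ℝ), ((t * x - η * φ t : ℝ) : EReal)

/-- `ψ(x) = φ*(x) - x`. -/
def psi (φ : ℝ → ℝ) (x : ℝ) : EReal := phiStar φ x - (x : EReal)

/-- Assumption Φ(i).  Here `φ : ℝ → ℝ` records the (finite) values of the divergence cost
on `[0,∞)`; the paper's extension `φ(x) = +∞` for `x < 0` is encoded separately wherever it
matters (nonnegativity of densities), and `φ(0) < ∞` is automatic since `φ` is real-valued. -/
structure PhiOne (φ : ℝ → ℝ) : Prop where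
  smooth : ContDiffOn ℝ 2 φ (Set.Ioi (0:ℝ))
  sconvex : StrictConvexOn ℝ (Set.Ici (0:ℝ)) φ
  one : φ 1 = 0
  done : deriv φ 1 = 0
  superlinear : Tendsto (fun x => φ x / x) atTop atTop
  dzero : ∃ L : EReal, L < 0 ∧
    Tendsto (fun x => ((deriv φ x : ℝ) : EReal)) (nhdsWithin 0 (Set.Ioi 0)) (nhds L)
  dinfty : ∃ L : EReal, 0 < L ∧ Tendsto (fun x => ((deriv φ x : ℝ) : EReal)) atTop (nhds L)
  delta2 : ∃ L : ℝ, Tendsto (fun x => x * deriv φ x / φ x) atTop (nhds L)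

variable {U : Type*} [MeasurableSpace U] {dθ d1 d2 d3 d4 : ℕ} {Γ : Type*}

/-- Stacked moment values/multipliers `(v1,v2,v3,v4)`. -/
abbrev Vec4 (d1 d2 d3 d4 : ℕ) :=
  (Fin d1 → ℝ) × (Fin d2 → ℝ) × (Fin d3 → ℝ) × (Fin d4 → ℝ)

/-- The targeted moments `P = (P1,P2)`. -/
abbrev Vec12 (d1 d2 : ℕ) := (Fin d1 → ℝ) × (Fin d2 → ℝ)

/-- `λ'g` for stacked vectors. -/
def dot4 (a b : Vec4 d1 d2 d3 d4) : ℝ :=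
  dot a.1 b.1 + dot a.2.1 b.2.1 + dot a.2.2.1 b.2.2.1 + dot a.2.2.2 b.2.2.2

/-- dot product on `Vec12`. -/
def dot12 (a b : Vec12 d1 d2) : ℝ := dot a.1 b.1 + dot a.2 b.2

/-- `λ ∈ Λ`, i.e. the multipliers on the inequality constraints are nonnegative. -/
def inLambda (l : Vec4 d1 d2 d3 d4) : Prop := (∀ i, 0 ≤ l.1 i) ∧ (∀ i, 0 ≤ l.2.2.1 i)

/-- `λ12'P`. -/
def dotP (l : Vec4 d1 d2 d3 d4) (P : Vec12 d1 d2) : ℝ := dot l.1 P.1 + dot l.2.1 P.2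

/-- The φ-divergence `D_φ(F‖F*)` (`= +∞` unless `F ≪ F*`). -/
def Dphi (φ : ℝ → ℝ) (Fstar F : Measure U) : ℝ≥0∞ :=
  if F ≪ Fstar then ∫⁻ u, ENNReal.ofReal (φ (F.rnDeriv Fstar u).toReal) ∂Fstar else ⊤

/-- Membership in the Orlicz heart `ℰ`: `∫ ψ(c|f|) dF* < ∞` for all `c > 0`. -/
def MemE (φ : ℝ → ℝ) (Fstar : Measure U) (f : U → ℝ) : Prop :=
  Measurable f ∧ ∀ c : ℝ, 0 < c → ∫⁻ u, erealToENNReal (psi φ (c * |f u|)) ∂Fstar < ⊤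

/-- The Orlicz norm `‖f‖_ψ = inf_{c>0} c⁻¹ (1 + ∫ ψ(c|f|) dF*)`. -/
def psiNorm (φ : ℝ → ℝ) (Fstar : Measure U) (f : U → ℝ) : ℝ≥0∞ :=
  ⨅ c ∈ Set.Ioi (0:ℝ),
    (ENNReal.ofReal c)⁻¹ * (1 + ∫⁻ u, erealToENNReal (psi φ (c * |f u|)) ∂Fstar)

/-- `E^{F*}[f]` for an `EReal`-valued integrand bounded below by `-c`. -/
def eExp (Fstar : Measure U) (c : ℝ) (f : U → EReal) : EReal :=
  ((∫⁻ u, erealToENNReal (f u + (c : EReal)) ∂Fstar : ℝ≥0∞) : EReal) - (c : EReal)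

/-- Sequential lower hemicontinuity of a correspondence `A` (sequences taken in `S`). -/
def LowerHemicontinuousAt {α β : Type*} [TopologicalSpace α] [TopologicalSpace β]
    (A : α → Set β) (S : Set α) (x : α) : Prop :=
  ∀ xs : ℕ → α, (∀ n, xs n ∈ S) → Tendsto xs atTop (nhds x) →
    ∀ y ∈ A x, ∃ ys : ℕ → β, (∀ n, ys n ∈ A (xs n)) ∧ Tendsto ys atTop (nhds y)

section Model

variable (φ : ℝ → ℝ) (Fstar : Measure U)
variable (g : U → (Fin dθ → ℝ) → Γ → Vec4 d1 d2 d3 d4)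
variable (k : U → (Fin dθ → ℝ) → Γ → ℝ)

/-- All components of `g(·,θ,γ)` are integrable under `F`. -/
def GIntegrable (θ : Fin dθ → ℝ) (γ : Γ) (F : Measure U) : Prop :=
  (∀ i, Integrable (fun u => (g u θ γ).1 i) F) ∧
  (∀ i, Integrable (fun u => (g u θ γ).2.1 i) F) ∧
  (∀ i, Integrable (fun u => (g u θ γ).2.2.1 i) F) ∧
  (∀ i, Integrable (fun u => (g u θ γ).2.2.2 i) F)

/-- The model constraints (1)–(4): `E^F[g1] ≤ P1`, `E^F[g2] = P2`, `E^F[g3] ≤ 0`, `E^F[g4] = 0`. -/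
def ConstraintsHold (θ : Fin dθ → ℝ) (γ : Γ) (P : Vec12 d1 d2) (F : Measure U) : Prop :=
  GIntegrable g θ γ F ∧
  (∀ i, ∫ u, (g u θ γ).1 i ∂F ≤ P.1 i) ∧
  (∀ i, ∫ u, (g u θ γ).2.1 i ∂F = P.2 i) ∧
  (∀ i, ∫ u, (g u θ γ).2.2.1 i ∂F ≤ 0) ∧
  (∀ i, ∫ u, (g u θ γ).2.2.2 i ∂F = 0)

/-- `F ∈ N_δ` and the model constraints hold at `(θ,γ,P)` under `F`. -/
def Feasible (δ : ℝ) (θ : Fin dθ → ℝ) (γ : Γ) (P : Vec12 d1 d2) (F : Measure U) : Prop :=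
  IsProbabilityMeasure F ∧ Dphi φ Fstar F ≤ ENNReal.ofReal δ ∧ ConstraintsHold g θ γ P F

/-- `κ̲_δ(θ;γ,P)`: primal lower value (explicit-dependence case); `= ⊤` if infeasible. -/
def kappaLow (δ : ℝ) (θ : Fin dθ → ℝ) (γ : Γ) (P : Vec12 d1 d2) : EReal :=
  sInf {x : EReal | ∃ F : Measure U, Feasible φ Fstar g δ θ γ P F ∧
    Integrable (fun u => k u θ γ) F ∧ x = ((∫ u, k u θ γ ∂F : ℝ) : EReal)}

/-- `κ̄_δ(θ;γ,P)`: primal upper value (explicit-dependence case); `= ⊥` if infeasible. -/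
def kappaHigh (δ : ℝ) (θ : Fin dθ → ℝ) (γ : Γ) (P : Vec12 d1 d2) : EReal :=
  sSup {x : EReal | ∃ F : Measure U, Feasible φ Fstar g δ θ γ P F ∧
    Integrable (fun u => k u θ γ) F ∧ x = ((∫ u, k u θ γ ∂F : ℝ) : EReal)}

/-- `κ̲*_δ(θ;γ,P)`: the dual program of `κ̲_δ`.  Multipliers with
`E^{F*}[(ηφ)*(...)] = +∞` contribute `-∞` to the supremum and are omitted from the
index set; `w` is a real-valued integrable version of the conjugate integrand. -/
def kappaLowDual (δ : ℝ) (θ : Fin dθ → ℝ) (γ : Γ) (P : Vec12 d1 d2) : EReal :=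
  sSup {x : EReal | ∃ η : ℝ, 0 ≤ η ∧ ∃ ζ : ℝ, ∃ l : Vec4 d1 d2 d3 d4, inLambda l ∧
    ∃ w : U → ℝ, Integrable w Fstar ∧
      (∀ᵐ u ∂Fstar, (w u : EReal) = etaPhiStar φ η (-(k u θ γ) - ζ - dot4 l (g u θ γ))) ∧
      x = ((-(∫ u, w u ∂Fstar) - η * δ - ζ - dotP l P : ℝ) : EReal)}

/-- `κ̄*_δ(θ;γ,P)`: the dual program of `κ̄_δ`. -/
def kappaHighDual (δ : ℝ) (θ : Fin dθ → ℝ) (γ : Γ) (P : Vec12 d1 d2) : EReal :=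
  sInf {x : EReal | ∃ η : ℝ, 0 ≤ η ∧ ∃ ζ : ℝ, ∃ l : Vec4 d1 d2 d3 d4, inLambda l ∧
    ∃ w : U → ℝ, Integrable w Fstar ∧
      (∀ᵐ u ∂Fstar, (w u : EReal) = etaPhiStar φ η (k u θ γ - ζ - dot4 l (g u θ γ))) ∧
      x = (((∫ u, w u ∂Fstar) + η * δ + ζ + dotP l P : ℝ) : EReal)}

/-- `δ*(θ;γ,P) = sup_{ζ,λ∈Λ} ( -E^{F*}[φ*(-ζ-λ'g)] - ζ - λ12'P )`. -/
def deltaStar (θ : Fin dθ → ℝ) (γ : Γ) (P : Vec12 d1 d2) : EReal :=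
  sSup {x : EReal | ∃ ζ : ℝ, ∃ l : Vec4 d1 d2 d3 d4, inLambda l ∧
    ∃ w : U → ℝ, Integrable w Fstar ∧
      (∀ᵐ u ∂Fstar, (w u : EReal) = phiStar φ (-ζ - dot4 l (g u θ γ))) ∧
      x = ((-(∫ u, w u ∂Fstar) - ζ - dotP l P : ℝ) : EReal)}

/-- `{E^F[g(U,θ,γ)] : F ∈ N_∞}`. -/
def momentSet (θ : Fin dθ → ℝ) (γ : Γ) : Set (Vec4 d1 d2 d3 d4) :=
  {v | ∃ F : Measure U, IsProbabilityMeasure F ∧ Dphi φ Fstar F < ⊤ ∧ GIntegrable g θ γ F ∧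
    v = ((fun i => ∫ u, (g u θ γ).1 i ∂F), (fun i => ∫ u, (g u θ γ).2.1 i ∂F),
         (fun i => ∫ u, (g u θ γ).2.2.1 i ∂F), (fun i => ∫ u, (g u θ γ).2.2.2 i ∂F))}

/-- The cone `𝒞 = ℝ^{d1}_{≥0} × {0} × ℝ^{d3}_{≥0} × {0}`. -/
def coneC : Set (Vec4 d1 d2 d3 d4) :=
  {c | (∀ i, 0 ≤ c.1 i) ∧ c.2.1 = 0 ∧ (∀ i, 0 ≤ c.2.2.1 i) ∧ c.2.2.2 = 0}

/-- Condition S at `(θ,γ,P)`. -/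
def ConditionS (θ : Fin dθ → ℝ) (γ : Γ) (P : Vec12 d1 d2) : Prop :=
  ((P.1, P.2, (0 : Fin d3 → ℝ), (0 : Fin d4 → ℝ)) : Vec4 d1 d2 d3 d4) ∈
    interior (momentSet φ Fstar g θ γ + coneC)

/-- Assumption Φ(ii): `k(·,θ,γ)` and each component of `g(·,θ,γ)` lie in `ℰ`. -/
def PhiTwo : Prop :=
  ∀ (θ : Fin dθ → ℝ) (γ : Γ), MemE φ Fstar (fun u => k u θ γ) ∧
    (∀ i, MemE φ Fstar (fun u => (g u θ γ).1 i)) ∧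
    (∀ i, MemE φ Fstar (fun u => (g u θ γ).2.1 i)) ∧
    (∀ i, MemE φ Fstar (fun u => (g u θ γ).2.2.1 i)) ∧
    (∀ i, MemE φ Fstar (fun u => (g u θ γ).2.2.2 i))

/-- `Θ_δ = {θ ∈ Θ : δ*(θ;γ0,P0) < δ}`. -/
def ThetaDelta (Θ : Set (Fin dθ → ℝ)) (γ0 : Γ) (P0 : Vec12 d1 d2) (δ : ℝ) :
    Set (Fin dθ → ℝ) :=
  {θ ∈ Θ | deltaStar φ Fstar g θ γ0 P0 < ((δ : ℝ) : EReal)}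

/-- Implicit-dependence lower value: `kI(θ,γ)` if feasible, `+∞` otherwise. -/
def kappaLowImp (kI : (Fin dθ → ℝ) → Γ → ℝ) (δ : ℝ) (θ : Fin dθ → ℝ) (γ : Γ)
    (P : Vec12 d1 d2) : EReal :=
  sInf {x : EReal | ∃ F : Measure U, Feasible φ Fstar g δ θ γ P F ∧ x = ((kI θ γ : ℝ) : EReal)}

/-- Implicit-dependence upper value: `kI(θ,γ)` if feasible, `-∞` otherwise. -/
def kappaHighImp (kI : (Fin dθ → ℝ) → Γ → ℝ) (δ : ℝ) (θ : Fin dθ → ℝ) (γ : Γ)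
    (P : Vec12 d1 d2) : EReal :=
  sSup {x : EReal | ∃ F : Measure U, Feasible φ Fstar g δ θ γ P F ∧ x = ((kI θ γ : ℝ) : EReal)}

/-- The criterion `K̲_δ(θ;γ,P)`. -/
def KLowCrit (δ : ℝ) (θ : Fin dθ → ℝ) (γ : Γ) (P : Vec12 d1 d2) : EReal :=
  if deltaStar φ Fstar g θ γ P < ((δ : ℝ) : EReal) then kappaLowDual φ Fstar g k δ θ γ P
  else if deltaStar φ Fstar g θ γ P = ((δ : ℝ) : EReal) then kappaLow φ Fstar g k δ θ γ P
  else ⊤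

/-- The criterion `K̄_δ(θ;γ,P)`. -/
def KHighCrit (δ : ℝ) (θ : Fin dθ → ℝ) (γ : Γ) (P : Vec12 d1 d2) : EReal :=
  if deltaStar φ Fstar g θ γ P < ((δ : ℝ) : EReal) then kappaHighDual φ Fstar g k δ θ γ P
  else if deltaStar φ Fstar g θ γ P = ((δ : ℝ) : EReal) then kappaHigh φ Fstar g k δ θ γ P
  else ⊥

/-- ℰ-continuity of a family `f(·,θ,γ)` in `(θ,γ)` on `Θ × Γ`. -/
def EContinuousIn [TopologicalSpace Γ] (Θ : Set (Fin dθ → ℝ))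
    (f : U → (Fin dθ → ℝ) → Γ → ℝ) : Prop :=
  ∀ θ0 ∈ Θ, ∀ γ0 : Γ,
    Tendsto (fun p : (Fin dθ → ℝ) × Γ => psiNorm φ Fstar (fun u => f u p.1 p.2 - f u θ0 γ0))
      (nhdsWithin (θ0, γ0) (Θ ×ˢ (Set.univ : Set Γ))) (nhds 0)

/-- Assumption M(i) for the moment functions. -/
def MOneG [TopologicalSpace Γ] (Θ : Set (Fin dθ → ℝ)) : Prop :=
  (∀ i, EContinuousIn φ Fstar Θ (fun u θ γ => (g u θ γ).1 i)) ∧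
  (∀ i, EContinuousIn φ Fstar Θ (fun u θ γ => (g u θ γ).2.1 i)) ∧
  (∀ i, EContinuousIn φ Fstar Θ (fun u θ γ => (g u θ γ).2.2.1 i)) ∧
  (∀ i, EContinuousIn φ Fstar Θ (fun u θ γ => (g u θ γ).2.2.2 i))

/-- Assumption M(v). -/
def MFive [TopologicalSpace Γ] (Θ : Set (Fin dθ → ℝ)) : Prop :=
  ∀ (c1 c2 : ℝ) (c3 : Vec4 d1 d2 d3 d4), ContinuousOn
    (fun p : (Fin dθ → ℝ) × Γ =>
      eExp Fstar (φ 0) (fun u => phiStar φ (c1 + c2 * k u p.1 p.2 + dot4 c3 (g u p.1 p.2))))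
    (Θ ×ˢ (Set.univ : Set Γ))

/-- Objective of the dual program for the lower value, as a function of `(η,ζ,λ)`. -/
def lowObj (δ : ℝ) (θ : Fin dθ → ℝ) (γ : Γ) (P : Vec12 d1 d2) (η ζ : ℝ)
    (l : Vec4 d1 d2 d3 d4) : EReal :=
  -(eExp Fstar (η * φ 0) (fun u => etaPhiStar φ η (-(k u θ γ) - ζ - dot4 l (g u θ γ))))
    - ((η * δ : ℝ) : EReal) - ((ζ : ℝ) : EReal) - ((dotP l P : ℝ) : EReal)

/-- Objective of the dual program for the upper value. -/
def highObj (δ : ℝ) (θ : Fin dθ → ℝ) (γ : Γ) (P : Vec12 d1 d2) (η ζ : ℝ)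
    (l : Vec4 d1 d2 d3 d4) : EReal :=
  (eExp Fstar (η * φ 0) (fun u => etaPhiStar φ η (k u θ γ - ζ - dot4 l (g u θ γ))))
    + ((η * δ : ℝ) : EReal) + ((ζ : ℝ) : EReal) + ((dotP l P : ℝ) : EReal)

/-- `Ξ̲_δ(θ)`: maximizers of the lower dual program. -/
def XiLow (δ : ℝ) (θ : Fin dθ → ℝ) (γ : Γ) (P : Vec12 d1 d2) :
    Set (ℝ × ℝ × Vec4 d1 d2 d3 d4) :=
  {ξ | 0 ≤ ξ.1 ∧ inLambda ξ.2.2 ∧ ∀ ξ' : ℝ × ℝ × Vec4 d1 d2 d3 d4, 0 ≤ ξ'.1 → inLambda ξ'.2.2 →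
    lowObj φ Fstar g k δ θ γ P ξ'.1 ξ'.2.1 ξ'.2.2 ≤ lowObj φ Fstar g k δ θ γ P ξ.1 ξ.2.1 ξ.2.2}

/-- `Ξ̄_δ(θ)`: minimizers of the upper dual program. -/
def XiHigh (δ : ℝ) (θ : Fin dθ → ℝ) (γ : Γ) (P : Vec12 d1 d2) :
    Set (ℝ × ℝ × Vec4 d1 d2 d3 d4) :=
  {ξ | 0 ≤ ξ.1 ∧ inLambda ξ.2.2 ∧ ∀ ξ' : ℝ × ℝ × Vec4 d1 d2 d3 d4, 0 ≤ ξ'.1 → inLambda ξ'.2.2 →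
    highObj φ Fstar g k δ θ γ P ξ.1 ξ.2.1 ξ.2.2 ≤ highObj φ Fstar g k δ θ γ P ξ'.1 ξ'.2.1 ξ'.2.2}

/-- `Λ̲_δ(θ)`: `(λ1,λ2)`-projections of `Ξ̲_δ(θ)`. -/
def LamLow (δ : ℝ) (θ : Fin dθ → ℝ) (γ : Γ) (P : Vec12 d1 d2) : Set (Vec12 d1 d2) :=
  {p | ∃ ξ ∈ XiLow φ Fstar g k δ θ γ P, ξ.2.2.1 = p.1 ∧ ξ.2.2.2.1 = p.2}

/-- `Λ̄_δ(θ)`: `(λ1,λ2)`-projections of `Ξ̄_δ(θ)`. -/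
def LamHigh (δ : ℝ) (θ : Fin dθ → ℝ) (γ : Γ) (P : Vec12 d1 d2) : Set (Vec12 d1 d2) :=
  {p | ∃ ξ ∈ XiHigh φ Fstar g k δ θ γ P, ξ.2.2.1 = p.1 ∧ ξ.2.2.2.1 = p.2}

end Model

end CFSens

namespace CFSens

section ChiSq

variable {U : Type*} [MeasurableSpace U] {dθ d2 d4 : ℕ}

/-- χ²-divergence cost `φ(x) = (x-1)²/2`. -/
def chiSq : ℝ → ℝ := fun x => (x - 1) ^ 2 / 2

/-- The moment functions `(g2 - ·, g4)` embedded in the general framework with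
`d1 = d3 = 0` and vacuous auxiliary parameter. -/
def gChi (g2 : U → (Fin dθ → ℝ) → Fin d2 → ℝ) (g4 : U → (Fin dθ → ℝ) → Fin d4 → ℝ) :
    U → (Fin dθ → ℝ) → Unit → Vec4 0 d2 0 d4 :=
  fun u θ _ => ((fun i => i.elim0), g2 u θ, (fun i => i.elim0), g4 u θ)

/-- counterfactual function embedded in the general framework. -/
def kChi (k : U → (Fin dθ → ℝ) → ℝ) : U → (Fin dθ → ℝ) → Unit → ℝ := fun u θ _ => k u θ

/-- targeted moments `(·, P20)` with `d1 = 0`. -/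
def PChi (P20 : Fin d2 → ℝ) : Vec12 0 d2 := ((fun i => i.elim0), P20)

/-- stacked moment function `h(u,θ) = (g2(u,θ) - P20, g4(u,θ))`. -/
def hFun (g2 : U → (Fin dθ → ℝ) → Fin d2 → ℝ) (g4 : U → (Fin dθ → ℝ) → Fin d4 → ℝ)
    (P20 : Fin d2 → ℝ) : U → (Fin dθ → ℝ) → (Fin d2 ⊕ Fin d4) → ℝ :=
  fun u θ => Sum.elim (fun i => g2 u θ i - P20 i) (fun j => g4 u θ j)

/-- `κ̲(N_δ)` for the χ² model with equality restrictions only. -/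
def chiLowValue (Fstar : Measure U) (g2 : U → (Fin dθ → ℝ) → Fin d2 → ℝ)
    (g4 : U → (Fin dθ → ℝ) → Fin d4 → ℝ) (k : U → (Fin dθ → ℝ) → ℝ)
    (Θ : Set (Fin dθ → ℝ)) (P20 : Fin d2 → ℝ) (δ : ℝ) : EReal :=
  ⨅ θ ∈ Θ, kappaLow chiSq Fstar (gChi g2 g4) (kChi k) δ θ () (PChi P20)

/-- `κ̄(N_δ)` for the χ² model with equality restrictions only. -/
def chiHighValue (Fstar : Measure U) (g2 : U → (Fin dθ → ℝ) → Fin d2 → ℝ)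
    (g4 : U → (Fin dθ → ℝ) → Fin d4 → ℝ) (k : U → (Fin dθ → ℝ) → ℝ)
    (Θ : Set (Fin dθ → ℝ)) (P20 : Fin d2 → ℝ) (δ : ℝ) : EReal :=
  ⨆ θ ∈ Θ, kappaHigh chiSq Fstar (gChi g2 g4) (kChi k) δ θ () (PChi P20)

/-- `κ̲(N_δ)` for the χ² model, implicit-dependence case. -/
def chiLowValueImp (Fstar : Measure U) (g2 : U → (Fin dθ → ℝ) → Fin d2 → ℝ)
    (g4 : U → (Fin dθ → ℝ) → Fin d4 → ℝ) (k : (Fin dθ → ℝ) → ℝ)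
    (Θ : Set (Fin dθ → ℝ)) (P20 : Fin d2 → ℝ) (δ : ℝ) : EReal :=
  ⨅ θ ∈ Θ, kappaLowImp chiSq Fstar (gChi g2 g4) (fun θ' _ => k θ') δ θ () (PChi P20)

/-- `κ̄(N_δ)` for the χ² model, implicit-dependence case. -/
def chiHighValueImp (Fstar : Measure U) (g2 : U → (Fin dθ → ℝ) → Fin d2 → ℝ)
    (g4 : U → (Fin dθ → ℝ) → Fin d4 → ℝ) (k : (Fin dθ → ℝ) → ℝ)
    (Θ : Set (Fin dθ → ℝ)) (P20 : Fin d2 → ℝ) (δ : ℝ) : EReal :=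
  ⨆ θ ∈ Θ, kappaHighImp chiSq Fstar (gChi g2 g4) (fun θ' _ => k θ') δ θ () (PChi P20)

/-- The influence function
`ι(u) = Πk₀(u) - J (H'V⁻¹H)⁻¹ H'V⁻¹ h₀(u)` (explicit-dependence case). -/
def influence (Fstar : Measure U) (k : U → (Fin dθ → ℝ) → ℝ)
    (h : U → (Fin dθ → ℝ) → (Fin d2 ⊕ Fin d4) → ℝ) (θstar : Fin dθ → ℝ)
    (H : Matrix (Fin d2 ⊕ Fin d4) (Fin dθ) ℝ)
    (V : Matrix (Fin d2 ⊕ Fin d4) (Fin d2 ⊕ Fin d4) ℝ)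
    (J : Fin dθ → ℝ) (u : U) : ℝ :=
  (k u θstar - ∫ v, k v θstar ∂Fstar)
  - dot (fun s => ∫ v, k v θstar * h v θstar s ∂Fstar)
      ((V⁻¹ - V⁻¹ * H * (H.transpose * V⁻¹ * H)⁻¹ * H.transpose * V⁻¹).mulVec (h u θstar))
  - dot J (((H.transpose * V⁻¹ * H)⁻¹ * H.transpose * V⁻¹).mulVec (h u θstar))

/-- The influence function `ι(u) = -J (H'V⁻¹H)⁻¹ H'V⁻¹ h₀(u)` (implicit-dependence case). -/
def influenceImp (h : U → (Fin dθ → ℝ) → (Fin d2 ⊕ Fin d4) → ℝ) (θstar : Fin dθ → ℝ)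
    (H : Matrix (Fin d2 ⊕ Fin d4) (Fin dθ) ℝ)
    (V : Matrix (Fin d2 ⊕ Fin d4) (Fin d2 ⊕ Fin d4) ℝ)
    (J : Fin dθ → ℝ) (u : U) : ℝ :=
  -(dot J (((H.transpose * V⁻¹ * H)⁻¹ * H.transpose * V⁻¹).mulVec (h u θstar)))

end ChiSq

end CFSens

open CFSens

namespace CFSens

section SquareIntegrable

variable {U ι : Type*} [MeasurableSpace U] {μ : Measure U}

theorem sq_integral_mul_le {a b : U → ℝ} (ha : MemLp a 2 μ) (hb : MemLp b 2 μ) :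
    (∫ u, a u * b u ∂μ) ^ 2 ≤ (∫ u, a u ^ 2 ∂μ) * ∫ u, b u ^ 2 ∂μ := by
  have hab : Integrable (fun u => a u * b u) μ := ha.integrable_mul hb
  have key : ∀ x : ℝ, 0 ≤ (∫ u, a u ^ 2 ∂μ) * (x * x) + (2 * ∫ u, a u * b u ∂μ) * x
      + ∫ u, b u ^ 2 ∂μ := by
    intro x
    have h1 : ∫ u, (x * a u + b u) ^ 2 ∂μ = (∫ u, a u ^ 2 ∂μ) * (x * x)
        + (2 * ∫ u, a u * b u ∂μ) * x + ∫ u, b u ^ 2 ∂μ := by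
      have h2 : ∀ u, (x * a u + b u) ^ 2 = (x * x) * a u ^ 2 + (2 * x) * (a u * b u) + b u ^ 2 := by
        intro u; ring
      have i1 : Integrable (fun u => (x * x) * a u ^ 2) μ := ha.integrable_sq.const_mul _
      have i2 : Integrable (fun u => (2 * x) * (a u * b u)) μ := hab.const_mul _
      have i12 : Integrable (fun u => (x * x) * a u ^ 2 + (2 * x) * (a u * b u)) μ := i1.add i2
      simp_rw [h2]
      rw [integral_add i12 hb.integrable_sq, integral_add i1 i2, integral_const_mul,
        integral_const_mul]
      ring
    rw [← h1]
    exact integral_nonneg fun u => sq_nonneg _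
  have := discrim_le_zero key
  unfold discrim at this
  linarith

theorem abs_integral_mul_le {a b : U → ℝ} (ha : MemLp a 2 μ) (hb : MemLp b 2 μ) :
    |∫ u, a u * b u ∂μ| ≤ √(∫ u, a u ^ 2 ∂μ) * √(∫ u, b u ^ 2 ∂μ) := by
  rw [← Real.sqrt_mul (integral_nonneg fun u => sq_nonneg _)]
  exact Real.abs_le_sqrt (sq_integral_mul_le ha hb)

theorem tendsto_integral_mul_zero {l : Filter ι} {f g : ι → U → ℝ} {A B : ℝ}
    (hf : ∀ i, MemLp (f i) 2 μ) (hg : ∀ i, MemLp (g i) 2 μ)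
    (hfA : Tendsto (fun i => ∫ u, f i u ^ 2 ∂μ) l (nhds A))
    (hgB : Tendsto (fun i => ∫ u, g i u ^ 2 ∂μ) l (nhds B)) (hAB : A * B = 0) :
    Tendsto (fun i => ∫ u, f i u * g i u ∂μ) l (nhds 0) := by
  apply squeeze_zero_norm (fun i => abs_integral_mul_le (hf i) (hg i))
  have := (hfA.sqrt).mul (hgB.sqrt)
  convert this using 2
  rcases mul_eq_zero.1 hAB with h | h <;> simp [h]

theorem tendsto_integral_mul {l : Filter ι} {f g : ι → U → ℝ} {f₀ g₀ : U → ℝ}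
    (hf : ∀ i, MemLp (f i) 2 μ) (hg : ∀ i, MemLp (g i) 2 μ)
    (hf₀ : MemLp f₀ 2 μ) (hg₀ : MemLp g₀ 2 μ)
    (hff : Tendsto (fun i => ∫ u, (f i u - f₀ u) ^ 2 ∂μ) l (nhds 0))
    (hgg : Tendsto (fun i => ∫ u, (g i u - g₀ u) ^ 2 ∂μ) l (nhds 0)) :
    Tendsto (fun i => ∫ u, f i u * g i u ∂μ) l (nhds (∫ u, f₀ u * g₀ u ∂μ)) := by
  have hdf : ∀ i, MemLp (fun u => f i u - f₀ u) 2 μ := fun i => (hf i).sub hf₀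
  have hdg : ∀ i, MemLp (fun u => g i u - g₀ u) 2 μ := fun i => (hg i).sub hg₀
  have h1 := tendsto_integral_mul_zero hdf hdg hff hgg (mul_zero 0)
  have h2 := tendsto_integral_mul_zero hdf (fun _ => hg₀) hff tendsto_const_nhds (zero_mul _)
  have h3 := tendsto_integral_mul_zero (fun _ => hf₀) hdg tendsto_const_nhds hgg (mul_zero _)
  have h4 := ((h1.add h2).add h3).add_const (∫ u, f₀ u * g₀ u ∂μ)
  simp only [add_zero, zero_add] at h4
  refine h4.congr fun i => ?_
  have i1 : Integrable (fun u => (f i u - f₀ u) * (g i u - g₀ u)) μ := (hdf i).integrable_mul (hdg i)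
  have i2 : Integrable (fun u => (f i u - f₀ u) * g₀ u) μ := (hdf i).integrable_mul hg₀
  have i3 : Integrable (fun u => f₀ u * (g i u - g₀ u)) μ := hf₀.integrable_mul (hdg i)
  have i4 : Integrable (fun u => f₀ u * g₀ u) μ := hf₀.integrable_mul hg₀
  have hsum : ∀ u, f i u * g i u = (f i u - f₀ u) * (g i u - g₀ u) + (f i u - f₀ u) * g₀ u
      + f₀ u * (g i u - g₀ u) + f₀ u * g₀ u := fun u => by ring
  have i12 : Integrable (fun u => (f i u - f₀ u) * (g i u - g₀ u) + (f i u - f₀ u) * g₀ u) μ :=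
    i1.add i2
  have i123 : Integrable (fun u => (f i u - f₀ u) * (g i u - g₀ u) + (f i u - f₀ u) * g₀ u
      + f₀ u * (g i u - g₀ u)) μ := i12.add i3
  simp_rw [hsum]
  rw [integral_add i123 i4, integral_add i12 i3, integral_add i1 i2]

theorem tendsto_integral_of_sq [IsProbabilityMeasure μ] {l : Filter ι} {f : ι → U → ℝ}
    {f₀ : U → ℝ} (hf : ∀ i, MemLp (f i) 2 μ) (hf₀ : MemLp f₀ 2 μ)
    (hff : Tendsto (fun i => ∫ u, (f i u - f₀ u) ^ 2 ∂μ) l (nhds 0)) :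
    Tendsto (fun i => ∫ u, f i u ∂μ) l (nhds (∫ u, f₀ u ∂μ)) := by
  have := tendsto_integral_mul (g := fun _ _ => (1 : ℝ)) (g₀ := fun _ => 1) hf
    (fun _ => memLp_const _) hf₀ (memLp_const _) hff (by simpa using tendsto_const_nhds)
  simpa using this

theorem integral_sq_sum_mul {S : Type*} [Fintype S] {h : U → S → ℝ}
    (hh : ∀ s, MemLp (fun u => h u s) 2 μ) (c : S → ℝ) :
    ∫ u, (∑ s, c s * h u s) ^ 2 ∂μ = ∑ s, ∑ t, c s * c t * ∫ u, h u s * h u t ∂μ := by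
  have hst : ∀ s t, Integrable (fun u => c s * c t * (h u s * h u t)) μ := fun s t =>
    Integrable.const_mul ((hh s).integrable_mul (hh t)) _
  have h1 : ∀ u, (∑ s, c s * h u s) ^ 2 = ∑ s, ∑ t, c s * c t * (h u s * h u t) := by
    intro u
    rw [sq, Finset.sum_mul_sum]
    exact Finset.sum_congr rfl fun s _ => Finset.sum_congr rfl fun t _ => by ring
  simp_rw [h1]
  rw [integral_finsetSum _ fun s _ => integrable_finsetSum _ fun t _ => hst s t]
  refine Finset.sum_congr rfl fun s _ => ?_
  rw [integral_finsetSum _ fun t _ => hst s t]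
  exact Finset.sum_congr rfl fun t _ => integral_const_mul _ _

/-- Truncation of `x` to `[-N, N]`. -/
def clip (N x : ℝ) : ℝ := max (-N) (min N x)

theorem abs_clip_le {N : ℝ} (hN : 0 ≤ N) (x : ℝ) : |clip N x| ≤ N :=
  abs_le.2 ⟨le_max_left _ _, max_le (by linarith) (min_le_left _ _)⟩

theorem clip_eq_self {N x : ℝ} (hx : |x| ≤ N) : clip N x = x := by
  rw [clip, min_eq_right (abs_le.1 hx).2, max_eq_right (abs_le.1 hx).1]

theorem abs_clip_sub_le {N : ℝ} (hN : 0 ≤ N) (x : ℝ) : |clip N x - x| ≤ |x| := by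
  rcases le_total |x| N with h | h
  · simp [clip_eq_self h]
  · rcases le_total 0 x with hx | hx
    · rw [abs_of_nonneg hx] at h
      rw [clip, min_eq_left h, max_eq_right (by linarith), abs_of_nonneg hx, abs_sub_comm,
        abs_of_nonneg (by linarith)]
      linarith
    · rw [abs_of_nonpos hx] at h
      rw [clip, min_eq_right (by linarith), max_eq_left (by linarith), abs_of_nonpos hx,
        abs_of_nonneg (by linarith)]
      linarith

theorem tendsto_integral_clip_sub_sq {l : Filter ι} [l.IsCountablyGenerated] {N : ι → ℝ}
    (hN : Tendsto N l atTop) {f : U → ℝ} (hfm : Measurable f) (hf : MemLp f 2 μ) :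
    Tendsto (fun i => ∫ u, (clip (N i) (f u) - f u) ^ 2 ∂μ) l (nhds 0) := by
  have := tendsto_integral_filter_of_dominated_convergence (μ := μ) (l := l)
    (F := fun i u => (clip (N i) (f u) - f u) ^ 2) (f := fun _ => 0) (fun u => f u ^ 2)
    (.of_forall fun i => by unfold clip; fun_prop)
    ((hN.eventually_ge_atTop 0).mono fun i hi => .of_forall fun u => by
      rw [Real.norm_eq_abs, abs_of_nonneg (sq_nonneg _)]
      exact sq_le_sq.2 (abs_clip_sub_le hi _))
    hf.integrable_sq
    (.of_forall fun u => by
      refine tendsto_const_nhds.congr' ?_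
      filter_upwards [hN.eventually_ge_atTop |f u|] with i hi
      simp [clip_eq_self hi])
  simpa using this

end SquareIntegrable

section LeftInverse

theorem mulVec_injective_of_rank_eq {m : Type*} {d : ℕ} {H : Matrix m (Fin d) ℝ} (hH : H.rank = d) :
    Function.Injective H.mulVec := by
  have h := H.mulVecLin.finrank_range_add_finrank_ker
  rw [← Matrix.rank, hH, Module.finrank_fin_fun] at h
  have h0 : Module.finrank ℝ (LinearMap.ker H.mulVecLin) = 0 := by omega
  exact LinearMap.ker_eq_bot.1 (Submodule.finrank_eq_zero.1 h0)

variable {m n : Type*} [Fintype m] [Fintype n] [DecidableEq m]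

theorem posDef_transpose_inv_mul {H : Matrix m n ℝ} {V : Matrix m m ℝ}
    (hH : Function.Injective H.mulVec) (hV : V.PosDef) : (H.transpose * V⁻¹ * H).PosDef := by
  have := hV.inv.conjTranspose_mul_mul_same (B := H) hH
  simpa using this

variable [DecidableEq n]

/-- The matrix `(H'V⁻¹H)⁻¹H'V⁻¹`. -/
def gmmInv (H : Matrix m n ℝ) (V : Matrix m m ℝ) : Matrix n m ℝ :=
  (H.transpose * V⁻¹ * H)⁻¹ * H.transpose * V⁻¹

theorem gmmInv_mul {H : Matrix m n ℝ} {V : Matrix m m ℝ}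
    (hH : Function.Injective H.mulVec) (hV : V.PosDef) : gmmInv H V * H = 1 := by
  have hG := (posDef_transpose_inv_mul hH hV).det_pos.ne'
  rw [gmmInv, Matrix.mul_assoc, Matrix.mul_assoc, ← Matrix.mul_assoc H.transpose]
  exact Matrix.nonsing_inv_mul _ (isUnit_iff_ne_zero.2 hG)

/-- `V A' = H (H'V⁻¹H)⁻¹` for `A = (H'V⁻¹H)⁻¹H'V⁻¹`. -/
theorem mul_gmmInv_transpose {H : Matrix m n ℝ} {V : Matrix m m ℝ}
    (hH : Function.Injective H.mulVec) (hV : V.PosDef) :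
    V * (gmmInv H V).transpose = H * (H.transpose * V⁻¹ * H)⁻¹ := by
  have hVt : V.transpose = V := by simpa using hV.isHermitian.eq
  have hGt : (H.transpose * V⁻¹ * H).transpose = H.transpose * V⁻¹ * H := by
    simpa using (posDef_transpose_inv_mul hH hV).isHermitian.eq
  have hVd : IsUnit V.det := isUnit_iff_ne_zero.2 hV.det_pos.ne'
  rw [gmmInv, Matrix.transpose_mul, Matrix.transpose_mul, Matrix.transpose_transpose,
    Matrix.transpose_nonsing_inv, Matrix.transpose_nonsing_inv, hVt, hGt,
    Matrix.mul_nonsing_inv_cancel_left _ _ hVd]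

end LeftInverse

end CFSens

namespace CFSens

section Tilt

variable {U S : Type*} [MeasurableSpace U]

/-- `1 + a` is a probability density with respect to `μ` within `χ²`-radius `δ` of `1` under
which all moments of `h` vanish. -/
structure IsTilt (μ : Measure U) (h : U → S → ℝ) (δ : ℝ) (a : U → ℝ) : Prop where
  measurable : Measurable a
  neg_one_le : ∀ u, -1 ≤ a u
  memLp : MemLp a 2 μ
  integral_eq_zero : ∫ u, a u ∂μ = 0
  integral_sq_le : ∫ u, a u ^ 2 ∂μ ≤ 2 * δ
  moment : ∀ s, ∫ u, a u * h u s ∂μ = -∫ u, h u s ∂μ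

variable {dθ d2 d4 : ℕ} {Fstar : Measure U} [IsProbabilityMeasure Fstar]
  {g2 : U → (Fin dθ → ℝ) → Fin d2 → ℝ} {g4 : U → (Fin dθ → ℝ) → Fin d4 → ℝ} {P20 : Fin d2 → ℝ}
  {θ : Fin dθ → ℝ} {δ : ℝ}

theorem constraintsHold_chi_iff {F : Measure U} [IsProbabilityMeasure F] :
    ConstraintsHold (gChi g2 g4) θ () (PChi P20) F ↔
      ∀ s, Integrable (fun u => hFun g2 g4 P20 u θ s) F ∧ ∫ u, hFun g2 g4 P20 u θ s ∂F = 0 := by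
  have hint : ∀ i, Integrable (fun u => g2 u θ i - P20 i) F ↔ Integrable (fun u => g2 u θ i) F := by
    intro i
    exact integrable_add_const_iff (c := -P20 i) (f := fun u => g2 u θ i)
  constructor
  · rintro ⟨⟨-, h2, -, h4⟩, -, e2, -, e4⟩ (i | i)
    · refine ⟨(hint i).2 (h2 i), ?_⟩
      have e := e2 i
      have hi : Integrable (fun u => g2 u θ i) F := h2 i
      simp only [gChi, PChi, hFun, Sum.elim_inl] at e ⊢
      rw [integral_sub hi (integrable_const _), e]
      simp
    · exact ⟨h4 i, e4 i⟩
  · intro h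
    have h2 : ∀ i, Integrable (fun u => g2 u θ i) F := fun i => (hint i).1 (h (Sum.inl i)).1
    refine ⟨⟨fun i => i.elim0, h2, fun i => i.elim0, fun i => (h (Sum.inr i)).1⟩,
      fun i => i.elim0, fun i => ?_, fun i => i.elim0, fun i => (h (Sum.inr i)).2⟩
    have e := (h (Sum.inl i)).2
    simp only [gChi, PChi, hFun, Sum.elim_inl] at e ⊢
    rw [integral_sub (h2 i) (integrable_const _)] at e
    simp at e
    linarith

theorem exists_isTilt_of_feasible (hδ : 0 ≤ δ)
    (hh : ∀ s, MemLp (fun u => hFun g2 g4 P20 u θ s) 2 Fstar) {F : Measure U}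
    (hF : Feasible chiSq Fstar (gChi g2 g4) δ θ () (PChi P20) F) :
    ∃ a, IsTilt Fstar (fun u => hFun g2 g4 P20 u θ) δ a := by
  obtain ⟨hprob, hD, hC⟩ := hF
  rw [constraintsHold_chi_iff] at hC
  by_cases hac : F ≪ Fstar
  swap
  · simp [Dphi, hac] at hD
  rw [Dphi, if_pos hac] at hD
  have hm : Measurable fun u => (F.rnDeriv Fstar u).toReal - 1 :=
    (F.measurable_rnDeriv Fstar).ennreal_toReal.sub_const 1
  have hi : Integrable (fun u => ((F.rnDeriv Fstar u).toReal - 1) ^ 2 / 2) Fstar := by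
    rw [← lintegral_ofReal_ne_top_iff_integrable
      ((hm.pow_const 2).div_const 2).aestronglyMeasurable (.of_forall fun u => by positivity)]
    exact (hD.trans_lt ENNReal.ofReal_lt_top).ne
  have hL : MemLp (fun u => (F.rnDeriv Fstar u).toReal - 1) 2 Fstar :=
    (memLp_two_iff_integrable_sq hm.aestronglyMeasurable).2 (by simpa using hi.mul_const 2)
  refine ⟨fun u => (F.rnDeriv Fstar u).toReal - 1, hm, fun u => ?_, hL, ?_, ?_, fun s => ?_⟩
  · linarith [ENNReal.toReal_nonneg (a := F.rnDeriv Fstar u)]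
  · rw [integral_sub Measure.integrable_toReal_rnDeriv (integrable_const _),
      Measure.integral_toReal_rnDeriv hac]
    simp
  · unfold chiSq at hD
    rw [← ofReal_integral_eq_lintegral_ofReal hi (.of_forall fun u => by positivity),
      ENNReal.ofReal_le_ofReal_iff hδ, integral_div] at hD
    linarith
  · have h1 := integral_rnDeriv_smul hac (f := fun u => hFun g2 g4 P20 u θ s)
    rw [(hC s).2] at h1
    simp only [smul_eq_mul] at h1
    have h2 : Integrable (fun u => (F.rnDeriv Fstar u).toReal * hFun g2 g4 P20 u θ s) Fstar :=
      (integrable_rnDeriv_smul_iff hac).2 (hC s).1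
    have h3 : Integrable (fun u => hFun g2 g4 P20 u θ s) Fstar := (hh s).integrable one_le_two
    simp_rw [sub_mul, one_mul]
    rw [integral_sub h2 h3, h1, zero_sub]

theorem exists_feasible_of_isTilt
    (hh : ∀ s, MemLp (fun u => hFun g2 g4 P20 u θ s) 2 Fstar) {a : U → ℝ}
    (ha : IsTilt Fstar (fun u => hFun g2 g4 P20 u θ) δ a) :
    ∃ F, Feasible chiSq Fstar (gChi g2 g4) δ θ () (PChi P20) F := by
  have hm : Measurable fun u => ENNReal.ofReal (1 + a u) := by
    have := ha.measurable
    fun_prop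
  have hnn : ∀ u, 0 ≤ 1 + a u := fun u => by linarith [ha.neg_one_le u]
  have hai : Integrable a Fstar := ha.memLp.integrable one_le_two
  have hprob : IsProbabilityMeasure (Fstar.withDensity fun u => ENNReal.ofReal (1 + a u)) := by
    constructor
    rw [withDensity_apply _ MeasurableSet.univ, Measure.restrict_univ,
      ← ofReal_integral_eq_lintegral_ofReal (f := fun u => 1 + a u)
        ((integrable_const _).add hai) (.of_forall hnn),
      integral_add (integrable_const _) hai, ha.integral_eq_zero]
    simp
  have hac : Fstar.withDensity (fun u => ENNReal.ofReal (1 + a u)) ≪ Fstar :=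
    withDensity_absolutelyContinuous _ _
  refine ⟨Fstar.withDensity fun u => ENNReal.ofReal (1 + a u), hprob, ?_, ?_⟩
  · rw [Dphi, if_pos hac]
    have h1 : ∫⁻ u, ENNReal.ofReal (chiSq ((Fstar.withDensity
          fun u => ENNReal.ofReal (1 + a u)).rnDeriv Fstar u).toReal) ∂Fstar
        = ∫⁻ u, ENNReal.ofReal (a u ^ 2 / 2) ∂Fstar := by
      refine lintegral_congr_ae ?_
      filter_upwards [Measure.rnDeriv_withDensity Fstar hm] with u hu
      rw [hu, ENNReal.toReal_ofReal (hnn u), chiSq, add_sub_cancel_left]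
    rw [h1, ← ofReal_integral_eq_lintegral_ofReal (ha.memLp.integrable_sq.div_const 2)
      (.of_forall fun u => by positivity), integral_div]
    exact ENNReal.ofReal_le_ofReal (by linarith [ha.integral_sq_le])
  · rw [constraintsHold_chi_iff]
    intro s
    have h3 : Integrable (fun u => hFun g2 g4 P20 u θ s) Fstar := (hh s).integrable one_le_two
    have h4 : Integrable (fun u => a u * hFun g2 g4 P20 u θ s) Fstar :=
      ha.memLp.integrable_mul (hh s)
    rw [integrable_withDensity_iff_integrable_smul' hm (.of_forall fun u => ENNReal.ofReal_lt_top),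
      integral_withDensity_eq_integral_toReal_smul hm (.of_forall fun u => ENNReal.ofReal_lt_top)]
    simp_rw [ENNReal.toReal_ofReal (hnn _), smul_eq_mul, add_mul, one_mul]
    exact ⟨h3.add h4, by rw [integral_add h3 h4, ha.moment s, add_neg_cancel]⟩

end Tilt

end CFSens

namespace CFSens

section UpperBound

open Asymptotics

variable {U S n : Type*} [MeasurableSpace U]
  {μ : Measure U} {h : U → (n → ℝ) → S → ℝ} {Θ : Set (n → ℝ)} {θstar : n → ℝ}

/-- A tilt of radius `p.2` at the parameter `p.1`, and `0` if there is none. -/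
def tiltOf (μ : Measure U) (h : U → (n → ℝ) → S → ℝ) (p : (n → ℝ) × ℝ) : U → ℝ :=
  if H : ∃ a, IsTilt μ (fun u => h u p.1) p.2 a then H.choose else 0

/-- Pairs of a parameter in `Θ` and a radius for which the parameter is feasible. -/
def tiltSet (μ : Measure U) (h : U → (n → ℝ) → S → ℝ) (Θ : Set (n → ℝ)) : Set ((n → ℝ) × ℝ) :=
  {p | p.1 ∈ Θ ∧ ∃ a, IsTilt μ (fun u => h u p.1) p.2 a}

/-- The filter of feasible pairs with radius decreasing to `0`. -/
def tiltFilter (μ : Measure U) (h : U → (n → ℝ) → S → ℝ) (Θ : Set (n → ℝ)) :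
    Filter ((n → ℝ) × ℝ) :=
  comap Prod.snd (nhdsWithin 0 (Set.Ioi 0)) ⊓ 𝓟 (tiltSet μ h Θ)

theorem isTilt_tiltOf {p : (n → ℝ) × ℝ} (hp : p ∈ tiltSet μ h Θ) :
    IsTilt μ (fun u => h u p.1) p.2 (tiltOf μ h p) := by
  rw [tiltOf, dif_pos hp.2]
  exact hp.2.choose_spec

theorem memLp_tiltOf (p : (n → ℝ) × ℝ) : MemLp (tiltOf μ h p) 2 μ := by
  unfold tiltOf
  split_ifs with H
  · exact H.choose_spec.memLp
  · exact MemLp.zero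

theorem tendsto_integral_tiltOf_sq {l : Filter ((n → ℝ) × ℝ)} (hl : Tendsto Prod.snd l (nhds 0))
    (hlt : ∀ᶠ p in l, p ∈ tiltSet μ h Θ) :
    Tendsto (fun p => ∫ u, (tiltOf μ h p u) ^ 2 ∂μ) l (nhds 0) := by
  have h2 : Tendsto (fun p : (n → ℝ) × ℝ => 2 * p.2) l (nhds 0) := by
    simpa using hl.const_mul 2
  refine squeeze_zero' (.of_forall fun p => integral_nonneg fun u => sq_nonneg _) ?_ h2
  filter_upwards [hlt] with p hp using (isTilt_tiltOf hp).integral_sq_le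

theorem eventually_notMem_tiltSet [IsProbabilityMeasure μ]
    (hh : ∀ θ s, MemLp (fun u => h u θ s) 2 μ)
    (hhL2 : ∀ θ0 ∈ Θ, ∀ s, Tendsto (fun θ' => ∫ u, (h u θ' s - h u θ0 s) ^ 2 ∂μ)
      (nhdsWithin θ0 Θ) (nhds 0))
    (huniq : ∀ θ ∈ Θ, (∀ s, ∫ u, h u θ s ∂μ = 0) → θ = θstar)
    {θ0 : n → ℝ} (hθ0 : θ0 ∈ Θ) (hne : θ0 ≠ θstar) :
    ∀ᶠ p in nhds θ0 ×ˢ nhdsWithin (0 : ℝ) (Set.Ioi 0), p ∉ tiltSet μ h Θ := by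
  set l := (nhds θ0 ×ˢ nhdsWithin (0 : ℝ) (Set.Ioi 0)) ⊓ 𝓟 (tiltSet μ h Θ) with hl
  suffices hbot : l = ⊥ by
    rw [hl, inf_principal_eq_bot] at hbot
    exact hbot
  by_contra hbot
  have : l.NeBot := ⟨hbot⟩
  have hlt : ∀ᶠ p in l, p ∈ tiltSet μ h Θ := mem_inf_of_right (mem_principal_self _)
  have hsnd : Tendsto Prod.snd l (nhds 0) :=
    (tendsto_snd.mono_left inf_le_left).mono_right nhdsWithin_le_nhds
  have hfst : Tendsto Prod.fst l (nhdsWithin θ0 Θ) :=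
    tendsto_nhdsWithin_iff.2 ⟨tendsto_fst.mono_left inf_le_left, hlt.mono fun p hp => hp.1⟩
  refine hne (huniq θ0 hθ0 fun s => ?_)
  have h0 : Tendsto (fun p : (n → ℝ) × ℝ => ∫ u, (h u p.1 s - h u θ0 s) ^ 2 ∂μ) l (nhds 0) :=
    (hhL2 θ0 hθ0 s).comp hfst
  have h1 : Tendsto (fun p : (n → ℝ) × ℝ => ∫ u, h u p.1 s ∂μ) l (nhds (∫ u, h u θ0 s ∂μ)) :=
    tendsto_integral_of_sq (fun p => hh p.1 s) (hh θ0 s) h0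
  have ha := tendsto_integral_tiltOf_sq hsnd hlt
  have h2 : Tendsto (fun p : (n → ℝ) × ℝ => ∫ u, tiltOf μ h p u * h u p.1 s ∂μ) l
      (nhds (∫ u, 0 * h u θ0 s ∂μ)) :=
    tendsto_integral_mul (f₀ := fun _ => 0) memLp_tiltOf (fun p => hh p.1 s)
      MemLp.zero (hh θ0 s) (by simpa only [sub_zero] using ha) h0
  have h3 : Tendsto (fun p : (n → ℝ) × ℝ => -∫ u, h u p.1 s ∂μ) l
      (nhds (∫ u, 0 * h u θ0 s ∂μ)) :=
    h2.congr' (hlt.mono fun p hp => (isTilt_tiltOf hp).moment s)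
  have h4 := tendsto_nhds_unique h1.neg h3
  simpa using h4

theorem tendsto_fst_tiltFilter [IsProbabilityMeasure μ]
    (hh : ∀ θ s, MemLp (fun u => h u θ s) 2 μ)
    (hhL2 : ∀ θ0 ∈ Θ, ∀ s, Tendsto (fun θ' => ∫ u, (h u θ' s - h u θ0 s) ^ 2 ∂μ)
      (nhdsWithin θ0 Θ) (nhds 0))
    (hΘ : IsCompact Θ)
    (huniq : ∀ θ ∈ Θ, (∀ s, ∫ u, h u θ s ∂μ = 0) → θ = θstar) :
    Tendsto Prod.fst (tiltFilter μ h Θ) (nhdsWithin θstar Θ) := by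
  have hlt : ∀ᶠ p in tiltFilter μ h Θ, p ∈ tiltSet μ h Θ := mem_inf_of_right (mem_principal_self _)
  refine tendsto_nhdsWithin_iff.2 ⟨?_, hlt.mono fun p hp => hp.1⟩
  refine (nhds_basis_opens θstar).tendsto_right_iff.2 fun O hO => ?_
  have hK : IsCompact (Θ \ O) := hΘ.diff hO.2
  have hev : ∀ᶠ p in nhdsSet (Θ \ O) ×ˢ nhdsWithin (0 : ℝ) (Set.Ioi 0), p ∉ tiltSet μ h Θ := by
    rw [hK.nhdsSet_prod_eq_biSup]
    simp only [eventually_iSup]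
    intro θ0 hθ0
    refine eventually_notMem_tiltSet hh hhL2 huniq hθ0.1 ?_
    rintro rfl
    exact hθ0.2 hO.1
  obtain ⟨A, hA, D, hD, hAD⟩ := mem_prod_iff.1 hev
  have hD' : ∀ᶠ p in tiltFilter μ h Θ, p.2 ∈ D :=
    mem_inf_of_left (preimage_mem_comap hD)
  filter_upwards [hlt, hD'] with p hp hpD
  by_contra hpO
  exact hAD (Set.mk_mem_prod (subset_of_mem_nhdsSet hA ⟨hp.1, hpO⟩) hpD) hp

variable [Fintype S] [Fintype n] [DecidableEq n]

theorem abs_sub_le_of_isTilt [IsProbabilityMeasure μ]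
    (hh : ∀ θ s, MemLp (fun u => h u θ s) 2 μ)
    (hhL2 : ∀ θ0 ∈ Θ, ∀ s, Tendsto (fun θ' => ∫ u, (h u θ' s - h u θ0 s) ^ 2 ∂μ)
      (nhdsWithin θ0 Θ) (nhds 0))
    (hΘ : IsCompact Θ) (hθstar : θstar ∈ Θ) (hsolve : ∀ s, ∫ u, h u θstar s ∂μ = 0)
    (huniq : ∀ θ ∈ Θ, (∀ s, ∫ u, h u θ s ∂μ = 0) → θ = θstar)
    {H : Matrix S n ℝ} (hH : HasFDerivAt (fun θ' s => ∫ u, h u θ' s ∂μ)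
      (LinearMap.toContinuousLinearMap H.mulVecLin) θstar)
    {A : Matrix n S ℝ} (hAH : A * H = 1) {k : (n → ℝ) → ℝ} {J : n → ℝ}
    (hk : (fun θ => k θ - k θstar - J ⬝ᵥ (θ - θstar)) =o[nhds θstar] fun θ => θ - θstar)
    {ε : ℝ} (hε : 0 < ε) :
    ∀ᶠ δ in nhdsWithin (0 : ℝ) (Set.Ioi 0), ∀ θ ∈ Θ, (∃ a, IsTilt μ (fun u => h u θ) δ a) →
      |k θ - k θstar| ≤
        (√2 * √(∫ u, (J ⬝ᵥ A.mulVec (h u θstar)) ^ 2 ∂μ) + ε) * √δ := by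
  set L := tiltFilter μ h Θ with hL
  have hlt : ∀ᶠ p in L, p ∈ tiltSet μ h Θ := mem_inf_of_right (mem_principal_self _)
  have hpos : ∀ᶠ p in L, 0 < p.2 :=
    mem_inf_of_left (preimage_mem_comap self_mem_nhdsWithin)
  have hfst := tendsto_fst_tiltFilter hh hhL2 hΘ huniq
  have hfst' : Tendsto Prod.fst L (nhds θstar) := hfst.mono_right nhdsWithin_le_nhds
  set a := tiltOf μ h with ha
  set t : (n → ℝ) × ℝ → ℝ := fun p => √p.2 with ht
  have hat : ∀ᶠ p in L, √(∫ u, a p u ^ 2 ∂μ) ≤ √2 * t p := by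
    filter_upwards [hlt] with p hp
    rw [ht, ← Real.sqrt_mul (by norm_num)]
    exact Real.sqrt_le_sqrt (isTilt_tiltOf hp).integral_sq_le
  have hatO : (fun p => √(∫ u, a p u ^ 2 ∂μ)) =O[L] t := by
    refine IsBigO.of_bound (√2) (hat.mono fun p hp => ?_)
    rw [Real.norm_of_nonneg (Real.sqrt_nonneg _), Real.norm_of_nonneg (Real.sqrt_nonneg _)]
    exact hp
  have hx : (fun p s => ∫ u, a p u * h u θstar s ∂μ) =O[L] t := by
    refine isBigO_pi.2 fun s => ?_
    have h1 : (fun p => ∫ u, a p u * h u θstar s ∂μ) =O[L] fun p =>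
        √(∫ u, a p u ^ 2 ∂μ) * √(∫ u, h u θstar s ^ 2 ∂μ) :=
      IsBigO.of_bound 1 (.of_forall fun p => by
        rw [one_mul, Real.norm_of_nonneg (r := _ * _) (by positivity)]
        exact abs_integral_mul_le (memLp_tiltOf p) (hh θstar s))
    refine h1.trans ?_
    simpa [mul_comm] using hatO.const_mul_left (√(∫ u, h u θstar s ^ 2 ∂μ))
  have hr : (fun p s => ∫ u, a p u * (h u p.1 s - h u θstar s) ∂μ) =o[L] t := by
    refine isLittleO_pi.2 fun s => ?_
    have h1 : (fun p : (n → ℝ) × ℝ => ∫ u, a p u * (h u p.1 s - h u θstar s) ∂μ) =O[L] fun p =>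
        √(∫ u, a p u ^ 2 ∂μ) * √(∫ u, (h u p.1 s - h u θstar s) ^ 2 ∂μ) :=
      IsBigO.of_bound 1 (.of_forall fun p => by
        rw [one_mul, Real.norm_of_nonneg (r := _ * _) (by positivity)]
        exact abs_integral_mul_le (memLp_tiltOf p) ((hh p.1 s).sub (hh θstar s)))
    have h2 : (fun p : (n → ℝ) × ℝ => √(∫ u, (h u p.1 s - h u θstar s) ^ 2 ∂μ)) =o[L]
        fun _ => (1 : ℝ) := by
      rw [isLittleO_one_iff]
      simpa using ((hhL2 θstar hθstar s).comp hfst).sqrt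
    simpa using h1.trans_isLittleO (hatO.mul_isLittleO h2)
  have hm : ∀ᶠ p in L, (fun s => ∫ u, h u p.1 s ∂μ) =
      -(fun s => ∫ u, a p u * h u θstar s ∂μ)
        - fun s => ∫ u, a p u * (h u p.1 s - h u θstar s) ∂μ := by
    filter_upwards [hlt] with p hp
    ext s
    have h1 := (isTilt_tiltOf hp).moment s
    have i1 : Integrable (fun u => a p u * h u θstar s) μ :=
      (memLp_tiltOf p).integrable_mul (hh θstar s)
    have i2 : Integrable (fun u => a p u * h u p.1 s) μ := (memLp_tiltOf p).integrable_mul (hh p.1 s)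
    simp only [Pi.sub_apply, Pi.neg_apply]
    simp_rw [mul_sub]
    rw [integral_sub i2 i1]
    linarith
  have hmO : (fun (p : (n → ℝ) × ℝ) s => ∫ u, h u p.1 s ∂μ) =O[L] t := by
    refine (hx.neg_left.sub hr.isBigO).congr' (hm.mono fun p hp => hp.symm) .rfl
  set AL := LinearMap.toContinuousLinearMap A.mulVecLin with hAL
  have hlin : (fun p : (n → ℝ) × ℝ => (p.1 - θstar) - A.mulVec (fun s => ∫ u, h u p.1 s ∂μ))
      =o[L] fun p => p.1 - θstar := by
    have h1 := (hasFDerivAt_iff_isLittleO.1 hH).comp_tendsto hfst'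
    have h2 := ((AL.isBigO_comp _ L).trans_isLittleO h1).neg_left
    refine h2.congr_left fun p => ?_
    simp only [Function.comp, hAL, LinearMap.coe_toContinuousLinearMap', Matrix.mulVecLin_apply]
    rw [Matrix.mulVec_sub, Matrix.mulVec_sub, Matrix.mulVec_mulVec, hAH, Matrix.one_mulVec]
    have h0 : (fun s => ∫ u, h u θstar s ∂μ) = 0 := funext hsolve
    rw [h0, Matrix.mulVec_zero]
    abel
  have hΔ : (fun p : (n → ℝ) × ℝ => p.1 - θstar) =O[L] t := by
    have h1 := hlin.right_isBigO_sub
    refine (h1.congr_right fun p => ?_).trans ((AL.isBigO_comp _ L).trans hmO)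
    simp [hAL]
  set JL : (n → ℝ) →L[ℝ] ℝ := LinearMap.toContinuousLinearMap
    (LinearMap.mk (AddHom.mk (fun x => J ⬝ᵥ x) (dotProduct_add J)) (fun c x => dotProduct_smul c J x))
    with hJL
  have hJLa : ∀ x, JL x = J ⬝ᵥ x := fun x => rfl
  have hk1 : (fun p : (n → ℝ) × ℝ => k p.1 - k θstar - J ⬝ᵥ (p.1 - θstar)) =o[L] t :=
    (hk.comp_tendsto hfst').trans_isBigO hΔ
  have hk2 : (fun p : (n → ℝ) × ℝ => J ⬝ᵥ ((p.1 - θstar)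
      - A.mulVec (fun s => ∫ u, h u p.1 s ∂μ))) =o[L] t :=
    ((JL.isBigO_comp _ L).trans_isLittleO hlin).trans_isBigO hΔ
  have hk3 : (fun p => J ⬝ᵥ A.mulVec (fun s => ∫ u, a p u * (h u p.1 s - h u θstar s) ∂μ))
      =o[L] t := ((JL ∘L AL).isBigO_comp _ L).trans_isLittleO hr
  have hk4 : (fun p => k p.1 - k θstar
      + J ⬝ᵥ A.mulVec (fun s => ∫ u, a p u * h u θstar s ∂μ)) =o[L] t := by
    refine ((hk1.add hk2).sub hk3).congr' ?_ .rfl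
    filter_upwards [hm] with p hp
    rw [hp]
    simp only [Matrix.mulVec_sub, Matrix.mulVec_neg, dotProduct_sub, dotProduct_neg]
    ring
  have hι : ∀ p, J ⬝ᵥ A.mulVec (fun s => ∫ u, a p u * h u θstar s ∂μ)
      = ∫ u, a p u * (J ⬝ᵥ A.mulVec (h u θstar)) ∂μ := by
    intro p
    simp only [Matrix.dotProduct_mulVec]
    simp only [dotProduct, Finset.mul_sum]
    rw [integral_finsetSum]
    · refine Finset.sum_congr rfl fun s _ => ?_
      rw [← integral_const_mul]
      exact integral_congr_ae (.of_forall fun u => by ring)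
    · intro s _
      have : Integrable (fun u => a p u * h u θstar s) μ :=
        (memLp_tiltOf p).integrable_mul (hh θstar s)
      refine (this.const_mul (Matrix.vecMul J A s)).congr (.of_forall fun u => ?_)
      dsimp only
      ring
  have hιL : MemLp (fun u => J ⬝ᵥ A.mulVec (h u θstar)) 2 μ := by
    simp only [Matrix.dotProduct_mulVec]
    simp only [dotProduct]
    exact memLp_finsetSum _ fun s _ => (hh θstar s).const_mul _
  have hfin : ∀ᶠ p in L, |k p.1 - k θstar| ≤
      (√2 * √(∫ u, (J ⬝ᵥ A.mulVec (h u θstar)) ^ 2 ∂μ) + ε) * √p.2 := by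
    filter_upwards [hk4.bound hε, hat] with p hp1 hp2
    rw [hι, Real.norm_eq_abs, Real.norm_of_nonneg (Real.sqrt_nonneg _)] at hp1
    have h1 := (abs_integral_mul_le (memLp_tiltOf p) hιL).trans
      (mul_le_mul_of_nonneg_right hp2 (Real.sqrt_nonneg _))
    rw [abs_le] at hp1 h1 ⊢
    simp only [ht] at hp1 h1
    constructor <;> linarith
  rw [hL, tiltFilter, eventually_inf_principal, eventually_comap] at hfin
  filter_upwards [hfin] with δ hδ θ hθ hex
  exact hδ (θ, δ) rfl ⟨hθ, hex⟩

end UpperBound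

end CFSens

namespace CFSens

section LowerBound

open Asymptotics

variable {U S n : Type*} [MeasurableSpace U] [Fintype S] [Fintype n] [DecidableEq S]
  {μ : Measure U} {h : U → (n → ℝ) → S → ℝ} {Θ : Set (n → ℝ)} {θstar : n → ℝ}

/-- Truncated and recentred version of the random variable `f`. -/
def clipCentered (μ : Measure U) (f : U → ℝ) (N : ℝ) (u : U) : ℝ :=
  clip N (f u) - ∫ v, clip N (f v) ∂μ

theorem measurable_clip_comp {f : U → ℝ} (hf : Measurable f) (N : ℝ) :
    Measurable fun u => clip N (f u) := by
  unfold clip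
  fun_prop

theorem measurable_clipCentered {f : U → ℝ} (hf : Measurable f) (N : ℝ) :
    Measurable (clipCentered μ f N) :=
  (measurable_clip_comp hf N).sub_const _

theorem memLp_clip [IsProbabilityMeasure μ] {f : U → ℝ} (hf : Measurable f) {N : ℝ} (hN : 0 ≤ N) :
    MemLp (fun u => clip N (f u)) 2 μ :=
  MemLp.of_bound (measurable_clip_comp hf N).aestronglyMeasurable N
    (.of_forall fun _ => abs_clip_le hN _)

theorem memLp_clipCentered [IsProbabilityMeasure μ] {f : U → ℝ} (hf : Measurable f) {N : ℝ}
    (hN : 0 ≤ N) : MemLp (clipCentered μ f N) 2 μ :=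
  (memLp_clip hf hN).sub (memLp_const _)

theorem integral_clipCentered [IsProbabilityMeasure μ] {f : U → ℝ} (hf : Measurable f) {N : ℝ}
    (hN : 0 ≤ N) : ∫ u, clipCentered μ f N u ∂μ = 0 := by
  unfold clipCentered
  rw [integral_sub ((memLp_clip hf hN).integrable one_le_two) (integrable_const _)]
  simp

theorem abs_clipCentered_le [IsProbabilityMeasure μ] (f : U → ℝ) {N : ℝ} (hN : 0 ≤ N) (u : U) :
    |clipCentered μ f N u| ≤ 2 * N := by
  have h1 : |∫ v, clip N (f v) ∂μ| ≤ N := by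
    have := norm_integral_le_of_norm_le_const (μ := μ) (f := fun v => clip N (f v)) (C := N)
      (.of_forall fun v => abs_clip_le hN _)
    simpa using this
  exact (abs_sub _ _).trans (by linarith [abs_clip_le hN (f u)])

theorem tendsto_integral_clipCentered_sub_sq [IsProbabilityMeasure μ] {ι : Type*} {l : Filter ι}
    [l.IsCountablyGenerated] {N : ι → ℝ} (hN0 : ∀ i, 0 ≤ N i) (hN : Tendsto N l atTop) {f : U → ℝ}
    (hfm : Measurable f) (hf : MemLp f 2 μ) (hf0 : ∫ u, f u ∂μ = 0) :
    Tendsto (fun i => ∫ u, (clipCentered μ f (N i) u - f u) ^ 2 ∂μ) l (nhds 0) := by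
  have h1 := tendsto_integral_clip_sub_sq hN hfm hf
  have h2 : Tendsto (fun i => ∫ u, clip (N i) (f u) ∂μ) l (nhds (∫ u, f u ∂μ)) :=
    tendsto_integral_of_sq (fun i => memLp_clip hfm (hN0 i)) hf h1
  rw [hf0] at h2
  have h3 := (h1.const_mul 2).add ((h2.pow 2).const_mul 2)
  refine squeeze_zero (fun i => integral_nonneg fun u => sq_nonneg _) (fun i => ?_)
    (by simpa using h3)
  have i1 : Integrable (fun u => (clip (N i) (f u) - f u) ^ 2) μ :=
    ((memLp_clip hfm (hN0 i)).sub hf).integrable_sq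
  have h4 : ∫ u, 2 * (clip (N i) (f u) - f u) ^ 2 + 2 * (∫ v, clip (N i) (f v) ∂μ) ^ 2 ∂μ
      = 2 * ∫ u, (clip (N i) (f u) - f u) ^ 2 ∂μ + 2 * (∫ v, clip (N i) (f v) ∂μ) ^ 2 := by
    rw [integral_add (i1.const_mul 2) (integrable_const _), integral_const_mul]
    simp
  rw [← h4]
  refine integral_mono ((memLp_clipCentered hfm (hN0 i)).sub hf).integrable_sq
    ((i1.const_mul 2).add (integrable_const _)) fun u => ?_
  dsimp only [clipCentered]
  nlinarith [sq_nonneg ((clip (N i) (f u) - f u) + ∫ v, clip (N i) (f v) ∂μ)]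

theorem tendsto_sqrt_nhdsGT_zero :
    Tendsto Real.sqrt (nhdsWithin 0 (Set.Ioi 0)) (nhdsWithin 0 (Set.Ioi 0)) := by
  refine tendsto_nhdsWithin_iff.2 ⟨?_, ?_⟩
  · have := Real.continuous_sqrt.tendsto 0
    rw [Real.sqrt_zero] at this
    exact this.mono_left nhdsWithin_le_nhds
  · filter_upwards [self_mem_nhdsWithin] with δ hδ using Real.sqrt_pos.2 hδ

theorem eventually_exists_isTilt [IsProbabilityMeasure μ]
    (hmh : ∀ θ s, Measurable fun u => h u θ s)
    (hh : ∀ θ s, MemLp (fun u => h u θ s) 2 μ)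
    (hhL2 : ∀ s, Tendsto (fun θ' => ∫ u, (h u θ' s - h u θstar s) ^ 2 ∂μ)
      (nhds θstar) (nhds 0))
    (hsolve : ∀ s, ∫ u, h u θstar s ∂μ = 0)
    {H : Matrix S n ℝ} (hH : HasFDerivAt (fun θ' s => ∫ u, h u θ' s ∂μ)
      (LinearMap.toContinuousLinearMap H.mulVecLin) θstar)
    {V : Matrix S S ℝ} (hV : ∀ s t, V s t = ∫ u, h u θstar s * h u θstar t ∂μ) (hVpd : V.PosDef)
    {d : n → ℝ} {w : S → ℝ} (hw : V.mulVec w = H.mulVec d) (hQ : w ⬝ᵥ V.mulVec w < 2) :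
    ∀ᶠ δ in nhdsWithin (0 : ℝ) (Set.Ioi 0),
      ∃ a, IsTilt μ (fun u => h u (θstar + √δ • d)) δ a := by
  set l := nhdsWithin (0 : ℝ) (Set.Ioi 0) with hl
  have hsq : Tendsto Real.sqrt l l := tendsto_sqrt_nhdsGT_zero
  have hsq0 : Tendsto Real.sqrt l (nhds 0) := hsq.mono_right nhdsWithin_le_nhds
  set N : ℝ → ℝ := fun δ => (√√δ)⁻¹ with hNdef
  have hN0 : ∀ δ, 0 ≤ N δ := fun δ => inv_nonneg.2 (Real.sqrt_nonneg _)
  have hN : Tendsto N l atTop := tendsto_inv_nhdsGT_zero.comp (hsq.comp hsq)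
  have hθ : Tendsto (fun δ => θstar + √δ • d) l (nhds θstar) := by
    simpa using (hsq0.smul_const d).const_add θstar
  set b : ℝ → S → U → ℝ := fun δ s => clipCentered μ (fun u => h u θstar s) (N δ) with hb
  have hbL : ∀ δ s, MemLp (b δ s) 2 μ := fun δ s => memLp_clipCentered (hmh θstar s) (hN0 δ)
  have hbt : ∀ s, Tendsto (fun δ => ∫ u, (b δ s u - h u θstar s) ^ 2 ∂μ) l (nhds 0) := fun s =>
    tendsto_integral_clipCentered_sub_sq hN0 hN (hmh θstar s) (hh θstar s) (hsolve s)
  set M : ℝ → Matrix S S ℝ := fun δ => Matrix.of fun s j =>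
    ∫ u, h u (θstar + √δ • d) s * b δ j u ∂μ with hMdef
  have hM : Tendsto M l (nhds V) := by
    refine tendsto_pi_nhds.2 fun s => tendsto_pi_nhds.2 fun j => ?_
    rw [hV]
    exact tendsto_integral_mul (fun δ => hh _ s) (fun δ => hbL δ j) (hh θstar s) (hh θstar j)
      ((hhL2 s).comp hθ) (hbt j)
  have hVdet : V.det ≠ 0 := hVpd.det_pos.ne'
  have hMinv : Tendsto (fun δ => (M δ)⁻¹) l (nhds V⁻¹) := by
    refine (continuousAt_matrix_inv V ?_).tendsto.comp hM
    rw [Ring.inverse_eq_inv']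
    exact continuousAt_inv₀ hVdet
  have hMdet : ∀ᶠ δ in l, (M δ).det ≠ 0 :=
    ((continuous_id.matrix_det.tendsto V).comp hM).eventually_ne hVdet
  set m : ℝ → S → ℝ := fun δ s => ∫ u, h u (θstar + √δ • d) s ∂μ with hmdef
  have hm : Tendsto (fun δ => (√δ)⁻¹ • m δ) l (nhds (H.mulVec d)) := by
    have h1 : HasDerivAt (fun t : ℝ => θstar + t • d) d 0 := by
      simpa using ((hasDerivAt_id (0 : ℝ)).smul_const d).const_add θstar
    have h2 : HasFDerivAt (fun θ' s => ∫ u, h u θ' s ∂μ)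
      (LinearMap.toContinuousLinearMap H.mulVecLin) (θstar + (0 : ℝ) • d) := by simpa using hH
    have h3 := (h2.comp_hasDerivAt (0 : ℝ) h1).tendsto_slope_zero_right.comp hsq
    refine h3.congr fun δ => ?_
    simp only [Function.comp, zero_add, zero_smul, add_zero]
    have h0 : (fun s => ∫ u, h u θstar s ∂μ) = 0 := funext hsolve
    rw [h0, sub_zero]
  set e : ℝ → S → ℝ := fun δ => -((M δ)⁻¹.mulVec ((√δ)⁻¹ • m δ)) with hedef
  have he : Tendsto e l (nhds (-w)) := by
    have h1 : Tendsto (fun δ => (M δ)⁻¹.mulVec ((√δ)⁻¹ • m δ)) l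
        (nhds (V⁻¹.mulVec (H.mulVec d))) := by
      refine tendsto_pi_nhds.2 fun s => ?_
      simp only [Matrix.mulVec, dotProduct]
      exact tendsto_finsetSum _ fun t _ =>
        (tendsto_pi_nhds.1 (tendsto_pi_nhds.1 hMinv s) t).mul (tendsto_pi_nhds.1 hm t)
    rw [← hw, Matrix.mulVec_mulVec, Matrix.nonsing_inv_mul _ (isUnit_iff_ne_zero.2 hVdet),
      Matrix.one_mulVec] at h1
    exact h1.neg
  have hes : ∀ s, Tendsto (fun δ => e δ s) l (nhds (-w s)) := fun s => tendsto_pi_nhds.1 he s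
  have hW : Tendsto (fun δ => ∑ s, ∑ t, e δ s * e δ t * ∫ u, b δ s u * b δ t u ∂μ) l
      (nhds (w ⬝ᵥ V.mulVec w)) := by
    have h1 : Tendsto (fun δ => ∑ s, ∑ t, e δ s * e δ t * ∫ u, b δ s u * b δ t u ∂μ) l
        (nhds (∑ s, ∑ t, (-w s) * (-w t) * ∫ u, h u θstar s * h u θstar t ∂μ)) :=
      tendsto_finsetSum _ fun s _ => tendsto_finsetSum _ fun t _ =>
        ((hes s).mul (hes t)).mul (tendsto_integral_mul (fun δ => hbL δ s) (fun δ => hbL δ t)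
          (hh θstar s) (hh θstar t) (hbt s) (hbt t))
    convert h1 using 2
    simp only [dotProduct, Matrix.mulVec, Finset.mul_sum, hV]
    exact Finset.sum_congr rfl fun s _ => Finset.sum_congr rfl fun t _ => by ring
  have hsmall : Tendsto (fun δ => √√δ * (2 * ∑ s, |e δ s|)) l (nhds 0) := by
    have h1 := (hsq0.comp hsq).mul
      ((tendsto_finsetSum Finset.univ fun s _ => (hes s).abs).const_mul 2)
    simpa using h1
  filter_upwards [self_mem_nhdsWithin, hMdet, hW.eventually_lt_const hQ,
    hsmall.eventually_lt_const one_pos] with δ hδ hdet hW2 hs1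
  have hδ0 : (0 : ℝ) < δ := hδ
  have hsδ : 0 < √δ := Real.sqrt_pos.2 hδ0
  have hint : ∀ s, Integrable (b δ s) μ := fun s => (hbL δ s).integrable one_le_two
  refine ⟨fun u => √δ * ∑ s, e δ s * b δ s u, ?_, fun u => ?_, ?_, ?_, ?_, fun s => ?_⟩
  · exact (Finset.measurable_fun_sum _ fun s _ =>
      (measurable_clipCentered (hmh θstar s) (N δ)).const_mul (e δ s)).const_mul _
  · have h1 : |√δ * ∑ s, e δ s * b δ s u| ≤ √√δ * (2 * ∑ s, |e δ s|) := by
      rw [abs_mul, abs_of_pos hsδ]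
      calc √δ * |∑ s, e δ s * b δ s u| ≤ √δ * ∑ s, |e δ s| * (2 * N δ) := by
            gcongr
            refine (Finset.abs_sum_le_sum_abs _ _).trans (Finset.sum_le_sum fun s _ => ?_)
            rw [abs_mul]
            gcongr
            exact abs_clipCentered_le _ (hN0 δ) u
        _ = (√δ * N δ) * (2 * ∑ s, |e δ s|) := by rw [← Finset.sum_mul]; ring
        _ = √√δ * (2 * ∑ s, |e δ s|) := by
            congr 1
            rw [hNdef]
            dsimp only
            rw [← div_eq_mul_inv, Real.div_sqrt]
    linarith [(abs_le.1 h1).1]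
  · exact (memLp_finsetSum _ fun s _ => (hbL δ s).const_mul (e δ s)).const_mul _
  · rw [integral_const_mul, integral_finsetSum _ fun s _ => (hint s).const_mul _]
    have h0 : ∀ s, ∫ u, e δ s * b δ s u ∂μ = 0 := fun s => by
      rw [integral_const_mul]
      simp only [hb]
      rw [integral_clipCentered (hmh θstar s) (hN0 δ), mul_zero]
    simp [h0]
  · simp_rw [mul_pow]
    rw [integral_const_mul, Real.sq_sqrt hδ0.le,
      integral_sq_sum_mul (h := fun u s => b δ s u) (fun s => hbL δ s)]
    nlinarith
  · have h1 : ∀ u, (√δ * ∑ j, e δ j * b δ j u) * h u (θstar + √δ • d) s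
        = √δ * ∑ j, e δ j * (h u (θstar + √δ • d) s * b δ j u) := fun u => by
      rw [mul_assoc, Finset.sum_mul]
      congr 1
      exact Finset.sum_congr rfl fun j _ => by ring
    have h2 : ∀ j, Integrable (fun u => h u (θstar + √δ • d) s * b δ j u) μ := fun j =>
      (hh _ s).integrable_mul (hbL δ j)
    simp_rw [h1]
    rw [integral_const_mul, integral_finsetSum _ fun j _ => (h2 j).const_mul _]
    simp_rw [integral_const_mul]
    have h3 : (M δ).mulVec (e δ) = -((√δ)⁻¹ • m δ) := by
      rw [hedef]
      dsimp only
      rw [Matrix.mulVec_neg, Matrix.mulVec_mulVec,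
        Matrix.mul_nonsing_inv _ (isUnit_iff_ne_zero.2 hdet), Matrix.one_mulVec]
    have h4 := congrFun h3 s
    simp only [Matrix.mulVec, dotProduct, hMdef, Matrix.of_apply, Pi.neg_apply, Pi.smul_apply,
      smul_eq_mul] at h4
    have h5 : ∑ j, e δ j * ∫ u, h u (θstar + √δ • d) s * b δ j u ∂μ = -((√δ)⁻¹ * m δ s) := by
      rw [← h4]
      exact Finset.sum_congr rfl fun j _ => mul_comm _ _
    rw [h5]
    simp only [hmdef]
    field_simp

variable [DecidableEq n]

theorem eventually_exists_isTilt_add_le [IsProbabilityMeasure μ]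
    (hmh : ∀ θ s, Measurable fun u => h u θ s)
    (hh : ∀ θ s, MemLp (fun u => h u θ s) 2 μ)
    (hhL2 : ∀ s, Tendsto (fun θ' => ∫ u, (h u θ' s - h u θstar s) ^ 2 ∂μ)
      (nhds θstar) (nhds 0))
    (hΘ : Θ ∈ nhds θstar)
    (hsolve : ∀ s, ∫ u, h u θstar s ∂μ = 0)
    {H : Matrix S n ℝ} (hH : HasFDerivAt (fun θ' s => ∫ u, h u θ' s ∂μ)
      (LinearMap.toContinuousLinearMap H.mulVecLin) θstar) (hHinj : Function.Injective H.mulVec)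
    {V : Matrix S S ℝ} (hV : ∀ s t, V s t = ∫ u, h u θstar s * h u θstar t ∂μ) (hVpd : V.PosDef)
    {k : (n → ℝ) → ℝ} {J : n → ℝ}
    (hk : (fun θ => k θ - k θstar - J ⬝ᵥ (θ - θstar)) =o[nhds θstar] fun θ => θ - θstar)
    {c : ℝ} (hc : c < √2 * √(∫ u, (J ⬝ᵥ (gmmInv H V).mulVec (h u θstar)) ^ 2 ∂μ)) :
    ∀ᶠ δ in nhdsWithin (0 : ℝ) (Set.Ioi 0), ∃ θ ∈ Θ,
      (∃ a, IsTilt μ (fun u => h u θ) δ a) ∧ k θstar + c * √δ ≤ k θ := by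
  set v := ∫ u, (J ⬝ᵥ (gmmInv H V).mulVec (h u θstar)) ^ 2 ∂μ with hv
  have hv0 : 0 ≤ v := integral_nonneg fun u => sq_nonneg _
  set d := (H.transpose * V⁻¹ * H)⁻¹.mulVec J with hd
  set w := Matrix.vecMul J (gmmInv H V) with hw
  have hVw : V.mulVec w = H.mulVec d := by
    rw [hw, ← Matrix.mulVec_transpose, Matrix.mulVec_mulVec, mul_gmmInv_transpose hHinj hVpd, hd,
      Matrix.mulVec_mulVec]
  have hvw : w ⬝ᵥ V.mulVec w = v := by
    rw [hv]
    simp only [Matrix.dotProduct_mulVec J, ← hw]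
    simp only [dotProduct]
    rw [integral_sq_sum_mul (hh θstar)]
    simp only [Matrix.mulVec, dotProduct, Finset.mul_sum, hV]
    exact Finset.sum_congr rfl fun s _ => Finset.sum_congr rfl fun t _ => by ring
  have hJd : J ⬝ᵥ d = v := by
    rw [← hvw, hVw, hw, ← Matrix.dotProduct_mulVec, Matrix.mulVec_mulVec, gmmInv_mul hHinj hVpd,
      Matrix.one_mulVec]
  obtain ⟨r, hr, hcr⟩ : ∃ r : ℝ, r ^ 2 * v < 2 ∧ c < r * v := by
    rcases hv0.eq_or_lt with h0 | h0
    · refine ⟨0, by norm_num, ?_⟩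
      rw [← h0] at hc
      simpa using hc
    · have hs : 0 < √2 * √v := by positivity
      have hs2 : (√2 * √v) ^ 2 = 2 * v := by
        rw [mul_pow, Real.sq_sqrt (by norm_num), Real.sq_sqrt hv0]
      obtain ⟨x, hx1, hx2⟩ := exists_between (max_lt hc hs)
      obtain ⟨hx3, hx4⟩ := max_lt_iff.1 hx1
      refine ⟨x / v, ?_, by rwa [div_mul_cancel₀ _ h0.ne']⟩
      rw [div_pow, sq v, ← div_div, div_mul_cancel₀ _ h0.ne', div_lt_iff₀ h0, ← hs2]
      exact pow_lt_pow_left₀ hx2 hx4.le two_ne_zero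
  have hE := eventually_exists_isTilt (d := r • d) (w := r • w) hmh hh hhL2 hsolve hH hV hVpd
    (by rw [Matrix.mulVec_smul, Matrix.mulVec_smul, hVw])
    (by
      rw [Matrix.mulVec_smul, smul_dotProduct, dotProduct_smul, hvw, smul_eq_mul, smul_eq_mul]
      linarith [hr])
  have hsq0 : Tendsto Real.sqrt (nhdsWithin 0 (Set.Ioi 0)) (nhds 0) :=
    tendsto_sqrt_nhdsGT_zero.mono_right nhdsWithin_le_nhds
  have hθ : Tendsto (fun δ => θstar + √δ • (r • d)) (nhdsWithin 0 (Set.Ioi 0)) (nhds θstar) := by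
    simpa using (hsq0.smul_const (r • d)).const_add θstar
  have hO : (fun δ : ℝ => (θstar + √δ • (r • d)) - θstar) =O[nhdsWithin 0 (Set.Ioi 0)]
      fun δ => √δ := by
    simp only [add_sub_cancel_left]
    refine IsBigO.of_bound ‖r • d‖ (.of_forall fun δ => ?_)
    rw [norm_smul, mul_comm]
  have hk1 := ((hk.comp_tendsto hθ).trans_isBigO hO).bound (sub_pos.2 hcr)
  filter_upwards [hE, hθ hΘ, hk1] with δ h1 h2 h3
  refine ⟨_, h2, h1, ?_⟩
  simp only [Function.comp, add_sub_cancel_left, dotProduct_smul, hJd, smul_eq_mul] at h3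
  rw [Real.norm_eq_abs, Real.norm_of_nonneg (Real.sqrt_nonneg _), abs_le] at h3
  linarith [h3.1]

end LowerBound

end CFSens

namespace CFSens

section Values

/-- The difference quotient limit of an extended real function squeezed by multiples of `√δ`. -/
theorem tendsto_toReal_sub_div_sqrt {f : ℝ → EReal} {x τ : ℝ}
    (hupper : ∀ c, τ < c → ∀ᶠ δ in nhdsWithin (0 : ℝ) (Set.Ioi 0), f δ ≤ ((x + c * √δ : ℝ) : EReal))
    (hlower : ∀ c, c < τ → ∀ᶠ δ in nhdsWithin (0 : ℝ) (Set.Ioi 0),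
      ((x + c * √δ : ℝ) : EReal) ≤ f δ) :
    Tendsto (fun δ => ((f δ).toReal - x) / √δ) (nhdsWithin 0 (Set.Ioi 0)) (nhds τ) ∧
      ∀ᶠ δ in nhdsWithin (0 : ℝ) (Set.Ioi 0), (((f δ).toReal : ℝ) : EReal) = f δ := by
  have hreal : ∀ᶠ δ in nhdsWithin (0 : ℝ) (Set.Ioi 0), (((f δ).toReal : ℝ) : EReal) = f δ := by
    filter_upwards [hupper (τ + 1) (by linarith), hlower (τ - 1) (by linarith)] with δ h1 h2
    exact EReal.coe_toReal (ne_top_of_le_ne_top (EReal.coe_ne_top _) h1)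
      (ne_bot_of_le_ne_bot (EReal.coe_ne_bot _) h2)
  refine ⟨tendsto_order.2 ⟨fun c hc => ?_, fun c hc => ?_⟩, hreal⟩
  · obtain ⟨c', h1, h2⟩ := exists_between hc
    filter_upwards [hlower c' h2, hreal, self_mem_nhdsWithin] with δ h3 h4 hδ
    rw [← h4, EReal.coe_le_coe_iff] at h3
    have hs : 0 < √δ := Real.sqrt_pos.2 hδ
    rw [lt_div_iff₀ hs]
    nlinarith
  · obtain ⟨c', h1, h2⟩ := exists_between hc
    filter_upwards [hupper c' h1, hreal, self_mem_nhdsWithin] with δ h3 h4 hδ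
    rw [← h4, EReal.coe_le_coe_iff] at h3
    have hs : 0 < √δ := Real.sqrt_pos.2 hδ
    rw [div_lt_iff₀ hs]
    nlinarith

theorem tendsto_sq_width_div {hi lo : ℝ → EReal} {x τ : ℝ}
    (hi_upper : ∀ c, τ < c → ∀ᶠ δ in nhdsWithin (0 : ℝ) (Set.Ioi 0),
      hi δ ≤ ((x + c * √δ : ℝ) : EReal))
    (hi_lower : ∀ c, c < τ → ∀ᶠ δ in nhdsWithin (0 : ℝ) (Set.Ioi 0),
      ((x + c * √δ : ℝ) : EReal) ≤ hi δ)
    (lo_upper : ∀ c, -τ < c → ∀ᶠ δ in nhdsWithin (0 : ℝ) (Set.Ioi 0),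
      lo δ ≤ ((x + c * √δ : ℝ) : EReal))
    (lo_lower : ∀ c, c < -τ → ∀ᶠ δ in nhdsWithin (0 : ℝ) (Set.Ioi 0),
      ((x + c * √δ : ℝ) : EReal) ≤ lo δ) :
    Tendsto (fun δ : ℝ => (((4 * δ)⁻¹ : ℝ) : EReal) * ((hi δ - lo δ) * (hi δ - lo δ)))
      (nhdsWithin 0 (Set.Ioi 0)) (nhds ((τ ^ 2 : ℝ) : EReal)) := by
  obtain ⟨h1, h1'⟩ := tendsto_toReal_sub_div_sqrt hi_upper hi_lower
  obtain ⟨h2, h2'⟩ := tendsto_toReal_sub_div_sqrt lo_upper lo_lower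
  have h3 := ((h1.sub h2).pow 2).div_const 4
  rw [show (τ - -τ) ^ 2 / 4 = τ ^ 2 by ring] at h3
  refine ((continuous_coe_real_ereal.tendsto _).comp h3).congr' ?_
  filter_upwards [h1', h2', self_mem_nhdsWithin] with δ e1 e2 hδ
  have hδ0 : (0 : ℝ) < δ := hδ
  rw [← e1, ← e2, ← EReal.coe_sub, ← EReal.coe_mul,
    ← EReal.coe_mul, Function.comp_apply, EReal.coe_eq_coe_iff]
  rw [← sub_div, div_pow, Real.sq_sqrt hδ0.le]
  field_simp
  ring

variable {U : Type*} [MeasurableSpace U] {dθ d2 d4 : ℕ} {Fstar : Measure U}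
  [IsProbabilityMeasure Fstar]
  {g2 : U → (Fin dθ → ℝ) → Fin d2 → ℝ} {g4 : U → (Fin dθ → ℝ) → Fin d4 → ℝ}
  {k : (Fin dθ → ℝ) → ℝ} {Θ : Set (Fin dθ → ℝ)} {P20 : Fin d2 → ℝ} {δ x : ℝ}

theorem chiHighValueImp_le (hδ : 0 ≤ δ)
    (hh : ∀ θ s, MemLp (fun u => hFun g2 g4 P20 u θ s) 2 Fstar)
    (hx : ∀ θ ∈ Θ, (∃ a, IsTilt Fstar (fun u => hFun g2 g4 P20 u θ) δ a) → k θ ≤ x) :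
    chiHighValueImp Fstar g2 g4 k Θ P20 δ ≤ (x : EReal) := by
  refine iSup₂_le fun θ hθ => sSup_le ?_
  rintro _ ⟨F, hF, rfl⟩
  exact EReal.coe_le_coe_iff.2 (hx θ hθ (exists_isTilt_of_feasible hδ (hh θ) hF))

theorem le_chiHighValueImp (hh : ∀ θ s, MemLp (fun u => hFun g2 g4 P20 u θ s) 2 Fstar)
    (hx : ∃ θ ∈ Θ, (∃ a, IsTilt Fstar (fun u => hFun g2 g4 P20 u θ) δ a) ∧ x ≤ k θ) :
    (x : EReal) ≤ chiHighValueImp Fstar g2 g4 k Θ P20 δ := by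
  obtain ⟨θ, hθ, ⟨a, ha⟩, hxk⟩ := hx
  obtain ⟨F, hF⟩ := exists_feasible_of_isTilt (hh θ) ha
  have hle : (k θ : EReal) ≤
      kappaHighImp chiSq Fstar (gChi g2 g4) (fun θ' _ => k θ') δ θ () (PChi P20) :=
    le_sSup ⟨F, hF, rfl⟩
  exact (EReal.coe_le_coe_iff.2 hxk).trans (hle.trans (le_iSup₂ (f := fun θ (_ : θ ∈ Θ) =>
    kappaHighImp chiSq Fstar (gChi g2 g4) (fun θ' _ => k θ') δ θ () (PChi P20)) θ hθ))

theorem le_chiLowValueImp (hδ : 0 ≤ δ)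
    (hh : ∀ θ s, MemLp (fun u => hFun g2 g4 P20 u θ s) 2 Fstar)
    (hx : ∀ θ ∈ Θ, (∃ a, IsTilt Fstar (fun u => hFun g2 g4 P20 u θ) δ a) → x ≤ k θ) :
    (x : EReal) ≤ chiLowValueImp Fstar g2 g4 k Θ P20 δ := by
  refine le_iInf₂ fun θ hθ => le_sInf ?_
  rintro _ ⟨F, hF, rfl⟩
  exact EReal.coe_le_coe_iff.2 (hx θ hθ (exists_isTilt_of_feasible hδ (hh θ) hF))

theorem chiLowValueImp_le (hh : ∀ θ s, MemLp (fun u => hFun g2 g4 P20 u θ s) 2 Fstar)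
    (hx : ∃ θ ∈ Θ, (∃ a, IsTilt Fstar (fun u => hFun g2 g4 P20 u θ) δ a) ∧ k θ ≤ x) :
    chiLowValueImp Fstar g2 g4 k Θ P20 δ ≤ (x : EReal) := by
  obtain ⟨θ, hθ, ⟨a, ha⟩, hxk⟩ := hx
  obtain ⟨F, hF⟩ := exists_feasible_of_isTilt (hh θ) ha
  exact ((iInf₂_le (f := fun θ (_ : θ ∈ Θ) =>
      kappaLowImp chiSq Fstar (gChi g2 g4) (fun θ' _ => k θ') δ θ () (PChi P20)) θ hθ).trans
    (sInf_le ⟨F, hF, rfl⟩)).trans (EReal.coe_le_coe_iff.2 hxk)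

end Values

end CFSens

/-- **Theorem 6: local sensitivity, implicit-dependence case.**
Under χ²-divergence, Assumptions Φ(ii), M(i), M(iv) and the GMM-type regularity
conditions, the local sensitivity `s = lim_{δ↓0} (κ̄(N_δ) - κ̲(N_δ))²/(4δ)` exists and
equals `2 E^{F*}[ι(U)²]` with `ι(u) = -J(H'V⁻¹H)⁻¹H'V⁻¹h₀(u)`. -/
theorem local_sensitivity_implicit
    {U : Type*} [MeasurableSpace U] {dθ d2 d4 : ℕ}
    (Fstar : Measure U) [IsProbabilityMeasure Fstar]
    (g2 : U → (Fin dθ → ℝ) → Fin d2 → ℝ) (g4 : U → (Fin dθ → ℝ) → Fin d4 → ℝ)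
    (k : (Fin dθ → ℝ) → ℝ)
    (Θ : Set (Fin dθ → ℝ)) (P20 : Fin d2 → ℝ)
    -- Assumption Φ(ii) for χ²: finite second moments under F*
    (hmh : ∀ (θ : Fin dθ → ℝ) (s : Fin d2 ⊕ Fin d4),
      Measurable (fun u => hFun g2 g4 P20 u θ s))
    (hh2 : ∀ (θ : Fin dθ → ℝ) (s : Fin d2 ⊕ Fin d4),
      Integrable (fun u => (hFun g2 g4 P20 u θ s) ^ 2) Fstar)
    -- Assumption M(i) for χ²: L²(F*)-continuity of h in θ and continuity of k
    (hhL2 : ∀ θ0 ∈ Θ, ∀ s : Fin d2 ⊕ Fin d4,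
      Tendsto (fun θ' => ∫ u, (hFun g2 g4 P20 u θ' s - hFun g2 g4 P20 u θ0 s) ^ 2 ∂Fstar)
        (nhdsWithin θ0 Θ) (nhds 0))
    (hkcont : ContinuousOn k Θ)
    -- Assumption M(iv)
    (hM4 : IsCompact Θ)
    -- GMM-type regularity conditions
    (θstar : Fin dθ → ℝ) (hint : θstar ∈ interior Θ)
    (hsolve : ∀ s, ∫ u, hFun g2 g4 P20 u θstar s ∂Fstar = 0)
    (huniq : ∀ θ ∈ Θ, (∀ s, ∫ u, hFun g2 g4 P20 u θ s ∂Fstar = 0) → θ = θstar)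
    (H : Matrix (Fin d2 ⊕ Fin d4) (Fin dθ) ℝ)
    (hHdiff : HasFDerivAt (fun θ' => (fun s => ∫ u, hFun g2 g4 P20 u θ' s ∂Fstar))
        (LinearMap.toContinuousLinearMap (Matrix.mulVecLin H)) θstar)
    (hHcont : ContDiffAt ℝ 1 (fun θ' => (fun s => ∫ u, hFun g2 g4 P20 u θ' s ∂Fstar)) θstar)
    (hHrank : H.rank = dθ)
    (V : Matrix (Fin d2 ⊕ Fin d4) (Fin d2 ⊕ Fin d4) ℝ)
    (hVint : ∀ s t, Integrable (fun u => hFun g2 g4 P20 u θstar s * hFun g2 g4 P20 u θstar t) Fstar)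
    (hVval : ∀ s t, V s t = ∫ u, hFun g2 g4 P20 u θstar s * hFun g2 g4 P20 u θstar t ∂Fstar)
    (hVpd : V.PosDef)
    (J : Fin dθ → ℝ)
    (hJdiff : HasFDerivAt (fun θ' => (fun _ : Fin 1 => k θ'))
        (LinearMap.toContinuousLinearMap (Matrix.mulVecLin (Matrix.of (fun _ : Fin 1 => J)))) θstar)
    (hJcont : ContDiffAt ℝ 1 k θstar) :
    Tendsto (fun δ : ℝ => ((((4 * δ)⁻¹ : ℝ)) : EReal) *
        ((chiHighValueImp Fstar g2 g4 k Θ P20 δ - chiLowValueImp Fstar g2 g4 k Θ P20 δ) *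
         (chiHighValueImp Fstar g2 g4 k Θ P20 δ - chiLowValueImp Fstar g2 g4 k Θ P20 δ)))
      (nhdsWithin 0 (Set.Ioi 0))
      (nhds (((2 * ∫ u, (influenceImp (hFun g2 g4 P20) θstar H V J u) ^ 2 ∂Fstar : ℝ))
        : EReal)) := by
  have hh : ∀ θ s, MemLp (fun u => hFun g2 g4 P20 u θ s) 2 Fstar := fun θ s =>
    (memLp_two_iff_integrable_sq (hmh θ s).aestronglyMeasurable).2 (hh2 θ s)
  have hΘ : Θ ∈ nhds θstar := mem_interior_iff_mem_nhds.1 hint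
  have hθΘ : θstar ∈ Θ := mem_of_mem_nhds hΘ
  have hhL2' : ∀ s, Tendsto
      (fun θ' => ∫ u, (hFun g2 g4 P20 u θ' s - hFun g2 g4 P20 u θstar s) ^ 2 ∂Fstar)
      (nhds θstar) (nhds 0) := fun s => by
    simpa only [nhdsWithin_eq_nhds.2 hΘ] using hhL2 θstar hθΘ s
  have hHinj := mulVec_injective_of_rank_eq hHrank
  have hk : (fun θ => k θ - k θstar - dotProduct J (θ - θstar)) =o[nhds θstar]
      fun θ => θ - θstar :=
    Asymptotics.isLittleO_pi.1 hJdiff.isLittleO 0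
  have hk' : (fun θ => -k θ - -k θstar - dotProduct (-J) (θ - θstar)) =o[nhds θstar]
      fun θ => θ - θstar :=
    hk.neg_left.congr_left fun θ => by rw [neg_dotProduct]; ring
  set v := ∫ u, (dotProduct J ((gmmInv H V).mulVec (hFun g2 g4 P20 u θstar))) ^ 2 ∂Fstar with hv
  have hv0 : 0 ≤ v := integral_nonneg fun u => sq_nonneg _
  have hι : ∫ u, (influenceImp (hFun g2 g4 P20) θstar H V J u) ^ 2 ∂Fstar = v :=
    integral_congr_ae (.of_forall fun u => neg_sq _)
  have hbound : ∀ c, √2 * √v < c → ∀ᶠ δ in nhdsWithin (0 : ℝ) (Set.Ioi 0), ∀ θ ∈ Θ,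
      (∃ a, IsTilt Fstar (fun u => hFun g2 g4 P20 u θ) δ a) → |k θ - k θstar| ≤ c * √δ :=
    fun c hc => by
      simpa only [← hv, add_sub_cancel] using abs_sub_le_of_isTilt hh hhL2 hM4 hθΘ hsolve huniq
        hHdiff (gmmInv_mul hHinj hVpd) hk (sub_pos.2 hc)
  rw [hι, show 2 * v = (√2 * √v) ^ 2 by rw [mul_pow, Real.sq_sqrt two_pos.le, Real.sq_sqrt hv0]]
  refine tendsto_sq_width_div (x := k θstar) (fun c hc => ?_) (fun c hc => ?_) (fun c hc => ?_)
    fun c hc => ?_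
  · filter_upwards [hbound c hc, self_mem_nhdsWithin] with δ h1 hδ
    exact chiHighValueImp_le (le_of_lt hδ) hh fun θ hθ ha => by
      linarith [(abs_le.1 (h1 θ hθ ha)).2]
  · filter_upwards [eventually_exists_isTilt_add_le hmh hh hhL2' hΘ hsolve hHdiff hHinj hVval hVpd
      hk hc] with δ h1
    exact le_chiHighValueImp hh h1
  · have hc' : -c < √2 * √(∫ u, (dotProduct (-J)
        ((gmmInv H V).mulVec (hFun g2 g4 P20 u θstar))) ^ 2 ∂Fstar) := by
      simp only [neg_dotProduct, neg_sq, ← hv]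
      linarith
    filter_upwards [eventually_exists_isTilt_add_le (k := fun θ => -k θ) hmh hh hhL2' hΘ hsolve
      hHdiff hHinj hVval hVpd hk' hc'] with δ h1
    obtain ⟨θ, hθ, ha, hle⟩ := h1
    exact chiLowValueImp_le hh ⟨θ, hθ, ha, by linarith⟩
  · filter_upwards [hbound (-c) (by linarith), self_mem_nhdsWithin] with δ h1 hδ
    exact le_chiLowValueImp (le_of_lt hδ) hh fun θ hθ ha => by
      linarith [(abs_le.1 (h1 θ hθ ha)).1]
end
end

section
/- Limit of the extreme counterfactuals over expanding neighborhoods (Appendix Lemma: limits): under Assumptions Φ(i) and Φ(ii), κ̲(N_δ) → inf K_∞ and κ̄(N_δ) → sup K_∞ as δ → ∞, where K_∞ = {E^F[k(U,θ,γ0)] : θ ∈ Θ, F ∈ N_∞, the model constraints hold at (θ,γ0,P0) under F} (with the conventions inf ∅ = +∞, sup ∅ = −∞). -/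
open MeasureTheory Filter Set
open scoped ENNReal Pointwise Classical

noncomputable section

namespace CFSens

variable {U : Type*} [MeasurableSpace U] {dθ d1 d2 d3 d4 : ℕ} {Γ : Type*}

/-- `K_∞`: the set of counterfactual values `E^F[k(U,θ,γ0)]` over `θ ∈ Θ` and `F ∈ N_∞`
satisfying the model constraints at `(θ,γ0,P0)`. -/
def KInfty (φ : ℝ → ℝ) (Fstar : Measure U) (g : U → (Fin dθ → ℝ) → Γ → Vec4 d1 d2 d3 d4)
    (k : U → (Fin dθ → ℝ) → Γ → ℝ) (Θ : Set (Fin dθ → ℝ)) (γ0 : Γ)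
    (P0 : Vec12 d1 d2) : Set ℝ :=
  {x | ∃ θ ∈ Θ, ∃ F : Measure U, IsProbabilityMeasure F ∧ Dphi φ Fstar F < ⊤ ∧
    ConstraintsHold g θ γ0 P0 F ∧ Integrable (fun u => k u θ γ0) F ∧
    x = ∫ u, k u θ γ0 ∂F}

end CFSens

open CFSens

namespace CFSens

variable {U : Type*} [MeasurableSpace U] {dθ d1 d2 d3 d4 : ℕ} {Γ : Type*}
  {φ : ℝ → ℝ} {Fstar : Measure U} {g : U → (Fin dθ → ℝ) → Γ → Vec4 d1 d2 d3 d4}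
  {k : U → (Fin dθ → ℝ) → Γ → ℝ} {Θ : Set (Fin dθ → ℝ)} {θ : Fin dθ → ℝ} {γ : Γ}
  {P : Vec12 d1 d2}

theorem Feasible.mono {δ δ' : ℝ} {F : Measure U} (hδ : δ ≤ δ')
    (h : Feasible φ Fstar g δ θ γ P F) : Feasible φ Fstar g δ' θ γ P F :=
  ⟨h.1, h.2.1.trans (ENNReal.ofReal_le_ofReal hδ), h.2.2⟩

theorem antitone_kappaLow : Antitone fun δ : ℝ => kappaLow φ Fstar g k δ θ γ P :=
  fun _ _ hδ => sInf_le_sInf fun _ ⟨F, hF, hk⟩ => ⟨F, hF.mono hδ, hk⟩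

theorem monotone_kappaHigh : Monotone fun δ : ℝ => kappaHigh φ Fstar g k δ θ γ P :=
  fun _ _ hδ => sSup_le_sSup fun _ ⟨F, hF, hk⟩ => ⟨F, hF.mono hδ, hk⟩

/-- `K_∞` is the set of values attained at feasible distributions of some finite radius. -/
theorem mem_KInfty_iff {x : ℝ} : x ∈ KInfty φ Fstar g k Θ γ P ↔
    ∃ δ : ℝ, ∃ θ ∈ Θ, ∃ F : Measure U, Feasible φ Fstar g δ θ γ P F ∧
      Integrable (fun u => k u θ γ) F ∧ x = ∫ u, k u θ γ ∂F := by
  constructor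
  · rintro ⟨θ, hθ, F, hF, hD, hc, hk, hx⟩
    exact ⟨(Dphi φ Fstar F).toReal, θ, hθ, F, ⟨hF, (ENNReal.ofReal_toReal hD.ne).ge, hc⟩, hk, hx⟩
  · rintro ⟨δ, θ, hθ, F, ⟨hF, hD, hc⟩, hk, hx⟩
    exact ⟨θ, hθ, F, hF, hD.trans_lt ENNReal.ofReal_lt_top, hc, hk, hx⟩

theorem iInf_kappaLow_eq_sInf_KInfty :
    ⨅ δ : ℝ, ⨅ θ ∈ Θ, kappaLow φ Fstar g k δ θ γ P =
      sInf ((fun x : ℝ => (x : EReal)) '' KInfty φ Fstar g k Θ γ P) := by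
  apply le_antisymm
  · refine le_sInf ?_
    rintro _ ⟨x, hx, rfl⟩
    obtain ⟨δ, θ, hθ, F, hF, hk, rfl⟩ := mem_KInfty_iff.1 hx
    exact iInf_le_of_le δ (iInf₂_le_of_le θ hθ (sInf_le ⟨F, hF, hk, rfl⟩))
  · refine le_iInf fun δ => le_iInf₂ fun θ hθ => le_sInf ?_
    rintro _ ⟨F, hF, hk, rfl⟩
    exact sInf_le ⟨_, mem_KInfty_iff.2 ⟨δ, θ, hθ, F, hF, hk, rfl⟩, rfl⟩

theorem iSup_kappaHigh_eq_sSup_KInfty :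
    ⨆ δ : ℝ, ⨆ θ ∈ Θ, kappaHigh φ Fstar g k δ θ γ P =
      sSup ((fun x : ℝ => (x : EReal)) '' KInfty φ Fstar g k Θ γ P) := by
  apply le_antisymm
  · refine iSup_le fun δ => iSup₂_le fun θ hθ => sSup_le ?_
    rintro _ ⟨F, hF, hk, rfl⟩
    exact le_sSup ⟨_, mem_KInfty_iff.2 ⟨δ, θ, hθ, F, hF, hk, rfl⟩, rfl⟩
  · refine sSup_le ?_
    rintro _ ⟨x, hx, rfl⟩
    obtain ⟨δ, θ, hθ, F, hF, hk, rfl⟩ := mem_KInfty_iff.1 hx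
    exact le_iSup_of_le δ (le_iSup₂_of_le θ hθ (le_sSup ⟨F, hF, hk, rfl⟩))

end CFSens

/-- **Appendix Lemma: limits of the extreme counterfactuals.**
Under Assumptions Φ(i) and Φ(ii), `κ̲(N_δ) → inf K_∞` and `κ̄(N_δ) → sup K_∞` as
`δ → ∞` (with `inf ∅ = +∞`, `sup ∅ = -∞`). -/
theorem limits_over_expanding_neighborhoods
    {U : Type*} [MeasurableSpace U] {dθ d1 d2 d3 d4 : ℕ} {Γ : Type*}
    (φ : ℝ → ℝ) (Fstar : Measure U) [IsProbabilityMeasure Fstar]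
    (g : U → (Fin dθ → ℝ) → Γ → Vec4 d1 d2 d3 d4)
    (k : U → (Fin dθ → ℝ) → Γ → ℝ)
    (Θ : Set (Fin dθ → ℝ)) (γ0 : Γ) (P0 : Vec12 d1 d2)
    (hΦ1 : PhiOne φ)
    (hΦ2 : PhiTwo φ Fstar g k) :
    Tendsto (fun δ : ℝ => ⨅ θ ∈ Θ, kappaLow φ Fstar g k δ θ γ0 P0) atTop
      (nhds (sInf ((fun x : ℝ => (x : EReal)) '' KInfty φ Fstar g k Θ γ0 P0))) ∧
    Tendsto (fun δ : ℝ => ⨆ θ ∈ Θ, kappaHigh φ Fstar g k δ θ γ0 P0) atTop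
      (nhds (sSup ((fun x : ℝ => (x : EReal)) '' KInfty φ Fstar g k Θ γ0 P0))) := by
  rw [← iInf_kappaLow_eq_sInf_KInfty, ← iSup_kappaHigh_eq_sSup_KInfty]
  exact ⟨tendsto_atTop_iInf fun _ _ hδ => iInf₂_mono fun _ _ => antitone_kappaLow hδ,
    tendsto_atTop_iSup fun _ _ hδ => iSup₂_mono fun _ _ => monotone_kappaHigh hδ⟩
end
end

section
/- Conic duality over the full divergence class (Appendix Lemma: dual over N_∞): under Assumptions Φ(i) and Φ(ii), for every (θ,γ,P), κ̲*_∞(θ;γ,P) ≤ κ̲_∞(θ;γ,P) and κ̄_∞(θ;γ,P) ≤ κ̄*_∞(θ;γ,P), where κ̲*_∞(θ;γ,P) = sup over {λ ∈ Λ : F*-essinf( k(·,θ,γ) + λ'g(·,θ,γ) ) > −∞} of ( F*-essinf( k(·,θ,γ) + λ'g(·,θ,γ) ) − λ12'P ) and κ̄*_∞(θ;γ,P) = inf over {λ ∈ Λ : F*-esssup( k(·,θ,γ) − λ'g(·,θ,γ) ) < +∞} of ( F*-esssup( k(·,θ,γ) − λ'g(·,θ,γ) ) + λ12'P ). If in addition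 Condition S holds at (θ,γ,P), then strong duality holds: κ̲_∞(θ;γ,P) = κ̲*_∞(θ;γ,P) and κ̄_∞(θ;γ,P) = κ̄*_∞(θ;γ,P). -/
open MeasureTheory Filter Set
open scoped ENNReal Pointwise Classical

noncomputable section

namespace CFSens

variable {U : Type*} [MeasurableSpace U] {dθ d1 d2 d3 d4 : ℕ} {Γ : Type*}

/-- `κ̲_∞(θ;γ,P)`: the primal lower value over `N_∞`. -/
def kappaLowInfty (φ : ℝ → ℝ) (Fstar : Measure U)
    (g : U → (Fin dθ → ℝ) → Γ → Vec4 d1 d2 d3 d4) (k : U → (Fin dθ → ℝ) → Γ → ℝ)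
    (θ : Fin dθ → ℝ) (γ : Γ) (P : Vec12 d1 d2) : EReal :=
  sInf {x : EReal | ∃ F : Measure U, IsProbabilityMeasure F ∧ Dphi φ Fstar F < ⊤ ∧
    ConstraintsHold g θ γ P F ∧ Integrable (fun u => k u θ γ) F ∧
    x = ((∫ u, k u θ γ ∂F : ℝ) : EReal)}

/-- `κ̄_∞(θ;γ,P)`: the primal upper value over `N_∞`. -/
def kappaHighInfty (φ : ℝ → ℝ) (Fstar : Measure U)
    (g : U → (Fin dθ → ℝ) → Γ → Vec4 d1 d2 d3 d4) (k : U → (Fin dθ → ℝ) → Γ → ℝ)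
    (θ : Fin dθ → ℝ) (γ : Γ) (P : Vec12 d1 d2) : EReal :=
  sSup {x : EReal | ∃ F : Measure U, IsProbabilityMeasure F ∧ Dphi φ Fstar F < ⊤ ∧
    ConstraintsHold g θ γ P F ∧ Integrable (fun u => k u θ γ) F ∧
    x = ((∫ u, k u θ γ ∂F : ℝ) : EReal)}

/-- `κ̲*_∞(θ;γ,P) = sup_{λ∈Λ : F*-essinf(k+λ'g) > -∞} ( F*-essinf(k+λ'g) - λ12'P )`. -/
def kappaLowInftyDual (Fstar : Measure U)
    (g : U → (Fin dθ → ℝ) → Γ → Vec4 d1 d2 d3 d4) (k : U → (Fin dθ → ℝ) → Γ → ℝ)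
    (θ : Fin dθ → ℝ) (γ : Γ) (P : Vec12 d1 d2) : EReal :=
  sSup {x : EReal | ∃ l : Vec4 d1 d2 d3 d4, inLambda l ∧
    essInf (fun u => ((k u θ γ + dot4 l (g u θ γ) : ℝ) : EReal)) Fstar ≠ ⊥ ∧
    x = essInf (fun u => ((k u θ γ + dot4 l (g u θ γ) : ℝ) : EReal)) Fstar
        - ((dotP l P : ℝ) : EReal)}

/-- `κ̄*_∞(θ;γ,P) = inf_{λ∈Λ : F*-esssup(k-λ'g) < +∞} ( F*-esssup(k-λ'g) + λ12'P )`. -/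
def kappaHighInftyDual (Fstar : Measure U)
    (g : U → (Fin dθ → ℝ) → Γ → Vec4 d1 d2 d3 d4) (k : U → (Fin dθ → ℝ) → Γ → ℝ)
    (θ : Fin dθ → ℝ) (γ : Γ) (P : Vec12 d1 d2) : EReal :=
  sInf {x : EReal | ∃ l : Vec4 d1 d2 d3 d4, inLambda l ∧
    essSup (fun u => ((k u θ γ - dot4 l (g u θ γ) : ℝ) : EReal)) Fstar ≠ ⊤ ∧
    x = essSup (fun u => ((k u θ γ - dot4 l (g u θ γ) : ℝ) : EReal)) Fstar
        + ((dotP l P : ℝ) : EReal)}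

end CFSens

open CFSens

namespace CFSens

/-- A convex epigraph-like set `A ⊆ E × ℝ` whose projection is a neighbourhood of `p`, and whose
fibre over `p` is bounded below by `v`, lies above a non-vertical hyperplane through `(p, v)`. -/
lemma exists_supporting_functional {E : Type*} [NormedAddCommGroup E] [NormedSpace ℝ E]
    [FiniteDimensional ℝ E] {A : Set (E × ℝ)} (hA : Convex ℝ A)
    (hup : ∀ y r s, (y, r) ∈ A → r ≤ s → (y, s) ∈ A) {p : E} {v : ℝ}
    (hp : p ∈ interior (Prod.fst '' A)) (hv : ∀ r, (p, r) ∈ A → v ≤ r) :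
    ∃ f : E →ₗ[ℝ] ℝ, ∀ y r, (y, r) ∈ A → v + f p ≤ r + f y := by
  have hpv : (p, v) ∉ interior A := by
    intro h
    have hcont : Continuous fun t : ℝ => ((p, t) : E × ℝ) := by fun_prop
    have h1 : ∀ᶠ t in nhds v, (p, t) ∈ A :=
      hcont.continuousAt.eventually (mem_interior_iff_mem_nhds.1 h)
    obtain ⟨ε, hε, hball⟩ := Metric.eventually_nhds_iff.1 h1
    have h2 : (p, v - ε / 2) ∈ A := hball (by
      rw [Real.dist_eq, sub_sub_cancel_left, abs_neg, abs_of_pos] <;> linarith)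
    linarith [hv _ h2]
  have hint : (interior A).Nonempty := by
    obtain ⟨b, hb, hbs⟩ := exists_mem_interior_convexHull_affineBasis
      (mem_interior_iff_mem_nhds.1 hp)
    have hmem : ∀ i, ∃ r, (b i, r) ∈ A := by
      intro i
      obtain ⟨⟨y, r⟩, hy, hyi⟩ := hbs (subset_convexHull ℝ _ (mem_range_self i))
      exact ⟨r, by simpa only [← hyi] using hy⟩
    choose r hr using hmem
    obtain ⟨R, hR⟩ := (Set.finite_range r).bddAbove
    have hconv : Convex ℝ {y : E | (y, R) ∈ A} := by
      intro x hx y hy s t hs ht hst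
      have := hA hx hy hs ht hst
      have e : s * R + t * R = R := by rw [← add_mul, hst, one_mul]
      simpa [e] using this
    have hsub : convexHull ℝ (range b) ⊆ {y : E | (y, R) ∈ A} := by
      refine convexHull_min ?_ hconv
      rintro _ ⟨i, rfl⟩
      exact hup _ _ _ (hr i) (hR (mem_range_self i))
    refine ⟨(p, R + 1), mem_interior.2
      ⟨interior (convexHull ℝ (range b)) ×ˢ Ioi R, ?_, isOpen_interior.prod isOpen_Ioi,
        hb, by simp⟩⟩
    rintro ⟨y, s⟩ ⟨hy, hs⟩
    exact hup _ _ _ (hsub (interior_subset hy)) (le_of_lt hs)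
  obtain ⟨F, hF0, hF⟩ := geometric_hahn_banach_of_nonempty_interior_point hA hpv hint
  have hsplit : ∀ y r, F (y, r) = F (y, 0) + r * F (0, 1) := by
    intro y r
    have : ((y, r) : E × ℝ) = (y, 0) + r • (0, 1) := by simp
    rw [this, map_add, map_smul, smul_eq_mul]
  obtain ⟨⟨p', r₀⟩, hr₀, hp'⟩ := interior_subset hp
  obtain rfl : p' = p := hp'
  have hμ : F (0, 1) ≤ 0 := by
    by_contra! hpos
    have h1 := hF _ (hup _ _ _ hr₀ (le_max_left r₀ (v + 1)))
    rw [hsplit p' (max r₀ (v + 1)), hsplit p' v] at h1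
    nlinarith [le_max_right r₀ (v + 1)]
  have hμ0 : F (0, 1) ≠ 0 := by
    intro h0
    have hle : ∀ y ∈ Prod.fst '' A, F (y, 0) ≤ F (p', 0) := by
      rintro _ ⟨⟨y, r⟩, hy, rfl⟩
      have := hF _ hy
      rw [hsplit y r, hsplit p' v, h0] at this
      simpa using this
    have hmax : IsLocalMax (fun y : E => F (y, 0)) p' := by
      filter_upwards [mem_interior_iff_mem_nhds.1 hp] with y hy using hle y hy
    have hder : HasFDerivAt (fun y : E => F (y, 0)) (F.comp (ContinuousLinearMap.inl ℝ E ℝ)) p' :=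
      (F.comp (ContinuousLinearMap.inl ℝ E ℝ)).hasFDerivAt
    have hz := hmax.hasFDerivAt_eq_zero hder
    refine hF0 (ContinuousLinearMap.ext fun ⟨y, r⟩ => ?_)
    have hy : F (y, 0) = 0 := by simpa using DFunLike.congr_fun hz y
    rw [hsplit, hy, h0]; simp
  have hneg : F (0, 1) < 0 := lt_of_le_of_ne hμ hμ0
  refine ⟨(F (0, 1))⁻¹ • (F.comp (ContinuousLinearMap.inl ℝ E ℝ)).toLinearMap, fun y r hy => ?_⟩
  have h1 := hF _ hy
  rw [hsplit y r, hsplit p' v] at h1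
  have h2 := mul_le_mul_of_nonpos_left h1 (inv_nonpos.2 hμ)
  rw [mul_add, mul_add, mul_left_comm, inv_mul_cancel₀ hμ0, mul_left_comm,
    inv_mul_cancel₀ hμ0] at h2
  simp only [LinearMap.smul_apply, ContinuousLinearMap.coe_coe, ContinuousLinearMap.comp_apply,
    ContinuousLinearMap.inl_apply, smul_eq_mul]
  linarith

section Multipliers

variable {d1 d2 d3 d4 : ℕ}

lemma dot_single {ι : Type*} [Fintype ι] [DecidableEq ι] (a : ι → ℝ) (i : ι) :
    dot a (Pi.single i 1) = a i := by
  simp [dot, Pi.single_apply]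

lemma dot_zero {ι : Type*} [Fintype ι] (a : ι → ℝ) : dot a 0 = 0 := by
  simp [dot]

lemma exists_eq_dot {ι : Type*} [Fintype ι] (f : (ι → ℝ) →ₗ[ℝ] ℝ) :
    ∃ a, ∀ y, f y = dot a y := by
  refine ⟨fun i => f (fun j => if i = j then 1 else 0), fun y => ?_⟩
  rw [LinearMap.pi_apply_eq_sum_univ f y, dot]
  exact Finset.sum_congr rfl fun i _ => mul_comm _ _

lemma exists_eq_dot4 (f : Vec4 d1 d2 d3 d4 →ₗ[ℝ] ℝ) :
    ∃ l : Vec4 d1 d2 d3 d4, ∀ y, f y = dot4 l y := by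
  obtain ⟨l1, h1⟩ := exists_eq_dot (f ∘ₗ LinearMap.inl ℝ _ _)
  obtain ⟨l2, h2⟩ := exists_eq_dot (f ∘ₗ LinearMap.inr ℝ _ _ ∘ₗ LinearMap.inl ℝ _ _)
  obtain ⟨l3, h3⟩ := exists_eq_dot
    (f ∘ₗ LinearMap.inr ℝ _ _ ∘ₗ LinearMap.inr ℝ _ _ ∘ₗ LinearMap.inl ℝ _ _)
  obtain ⟨l4, h4⟩ := exists_eq_dot
    (f ∘ₗ LinearMap.inr ℝ _ _ ∘ₗ LinearMap.inr ℝ _ _ ∘ₗ LinearMap.inr ℝ _ _)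
  refine ⟨(l1, l2, l3, l4), fun y => ?_⟩
  rw [dot4, ← h1, ← h2, ← h3, ← h4]
  simp only [LinearMap.comp_apply, ← map_add]
  simp

lemma dot4_add (l x y : Vec4 d1 d2 d3 d4) : dot4 l (x + y) = dot4 l x + dot4 l y := by
  simp only [dot4, dot, Prod.fst_add, Prod.snd_add, Pi.add_apply, mul_add, Finset.sum_add_distrib]
  ring

lemma dot_le_dot_of_nonneg_left {ι : Type*} [Fintype ι] {a x y : ι → ℝ} (ha : ∀ i, 0 ≤ a i)
    (hxy : ∀ i, x i ≤ y i) : dot a x ≤ dot a y :=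
  Finset.sum_le_sum fun i _ => mul_le_mul_of_nonneg_left (hxy i) (ha i)

lemma inLambda_of_nonneg_on_coneC {l : Vec4 d1 d2 d3 d4}
    (h : ∀ c ∈ (coneC : Set (Vec4 d1 d2 d3 d4)), 0 ≤ dot4 l c) : inLambda l := by
  constructor
  · intro i
    have := h (Pi.single i 1, 0, 0, 0) ⟨fun j => ?_, rfl, fun _ => le_rfl, rfl⟩
    · simpa [dot4, dot_single, dot_zero] using this
    · exact (Pi.single_nonneg.2 zero_le_one : (0 : Fin d1 → ℝ) ≤ _) j
  · intro i
    have := h (0, 0, Pi.single i 1, 0) ⟨fun _ => le_rfl, rfl, fun j => ?_, rfl⟩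
    · simpa [dot4, dot_single, dot_zero] using this
    · exact (Pi.single_nonneg.2 zero_le_one : (0 : Fin d3 → ℝ) ≤ _) j

lemma smul_mem_coneC {c : Vec4 d1 d2 d3 d4} (hc : c ∈ (coneC : Set (Vec4 d1 d2 d3 d4))) {t : ℝ}
    (ht : 0 ≤ t) : t • c ∈ (coneC : Set (Vec4 d1 d2 d3 d4)) := by
  obtain ⟨h1, h2, h3, h4⟩ := hc
  exact ⟨fun i => mul_nonneg ht (h1 i), by simp [h2], fun i => mul_nonneg ht (h3 i), by simp [h4]⟩

lemma add_mem_coneC {c c' : Vec4 d1 d2 d3 d4} (hc : c ∈ (coneC : Set (Vec4 d1 d2 d3 d4)))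
    (hc' : c' ∈ (coneC : Set (Vec4 d1 d2 d3 d4))) :
    c + c' ∈ (coneC : Set (Vec4 d1 d2 d3 d4)) := by
  obtain ⟨h1, h2, h3, h4⟩ := hc
  obtain ⟨h1', h2', h3', h4'⟩ := hc'
  exact ⟨fun i => add_nonneg (h1 i) (h1' i), by simp [h2, h2'],
    fun i => add_nonneg (h3 i) (h3' i), by simp [h4, h4']⟩

lemma zero_mem_coneC : (0 : Vec4 d1 d2 d3 d4) ∈ (coneC : Set (Vec4 d1 d2 d3 d4)) :=
  ⟨fun _ => le_rfl, rfl, fun _ => le_rfl, rfl⟩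

end Multipliers

section Divergence

variable {U : Type*} [MeasurableSpace U] {φ : ℝ → ℝ} {Fstar : Measure U}

/-- The class `N_∞` of probability measures at finite divergence from `F*`. -/
def NInfty (φ : ℝ → ℝ) (Fstar : Measure U) : Set (Measure U) :=
  {F | IsProbabilityMeasure F ∧ Dphi φ Fstar F < ⊤}

lemma absolutelyContinuous_of_Dphi_lt_top {F : Measure U} (h : Dphi φ Fstar F < ⊤) :
    F ≪ Fstar := by
  by_contra hF
  simp [Dphi, hF] at h

lemma ofReal_le_erealToENNReal {a : ℝ} {x : EReal} (h : (a : EReal) ≤ x) :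
    ENNReal.ofReal a ≤ erealToENNReal x := by
  unfold erealToENNReal
  split_ifs with hx
  · exact le_top
  · exact ENNReal.ofReal_le_ofReal (by
      simpa using EReal.toReal_le_toReal h (EReal.coe_ne_bot a) hx)

lemma le_psi (φ : ℝ → ℝ) {t : ℝ} (ht : 0 ≤ t) (x : ℝ) :
    (((t - 1) * x - φ t : ℝ) : EReal) ≤ psi φ x := by
  have h : ((t * x - φ t : ℝ) : EReal) ≤ phiStar φ x :=
    le_iSup₂ (f := fun t (_ : t ∈ Ici (0 : ℝ)) => ((t * x - φ t : ℝ) : EReal)) t ht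
  have e : (((t - 1) * x - φ t : ℝ) : EReal) = ((t * x - φ t : ℝ) : EReal) - (x : EReal) := by
    rw [← EReal.coe_sub]; congr 1; ring
  rw [e]
  exact EReal.sub_le_sub h le_rfl

lemma PhiOne.measurable_comp (hφ : PhiOne φ) {h : U → ℝ} (hm : Measurable h)
    (h0 : ∀ u, 0 ≤ h u) : Measurable fun u => φ (h u) := by
  have h1 : Measurable ((Ioi (0 : ℝ)).piecewise φ fun _ => φ 0) :=
    hφ.smooth.continuousOn.measurable_piecewise continuousOn_const measurableSet_Ioi
  convert h1.comp hm using 2 with u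
  rcases (h0 u).eq_or_lt with h | h
  · simp [← h]
  · simp [Set.piecewise, h]

lemma MemE.integrable [IsProbabilityMeasure Fstar] (hφ : PhiOne φ) {f : U → ℝ}
    (hf : MemE φ Fstar f) {F : Measure U} (hF : F ∈ NInfty φ Fstar) : Integrable f F := by
  obtain ⟨_, hD⟩ := hF
  have hac := absolutelyContinuous_of_Dphi_lt_top hD
  rw [Dphi, if_pos hac] at hD
  rw [← integrable_rnDeriv_smul_iff hac]
  have hh : Measurable fun u => (F.rnDeriv Fstar u).toReal :=
    (Measure.measurable_rnDeriv _ _).ennreal_toReal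
  have hfm := hf.1
  have hφm := hφ.measurable_comp hh fun u => ENNReal.toReal_nonneg
  have hψ := hf.2 1 one_pos
  simp only [one_mul] at hψ
  refine ⟨(hh.smul hfm).aestronglyMeasurable, ?_⟩
  have hA : ∫⁻ u, ENNReal.ofReal (((F.rnDeriv Fstar u).toReal - 1) * |f u|
      - φ (F.rnDeriv Fstar u).toReal) ∂Fstar < ⊤ :=
    (lintegral_mono fun u => ofReal_le_erealToENNReal
      (le_psi φ ENNReal.toReal_nonneg _)).trans_lt hψ
  have hB : ∫⁻ u, ENNReal.ofReal ((2 - 1) * |f u| - φ 2) ∂Fstar < ⊤ :=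
    (lintegral_mono fun u => ofReal_le_erealToENNReal (le_psi φ zero_le_two _)).trans_lt hψ
  have hbound : ∀ u, ‖(F.rnDeriv Fstar u).toReal • f u‖ₑ ≤
      ENNReal.ofReal (((F.rnDeriv Fstar u).toReal - 1) * |f u| - φ (F.rnDeriv Fstar u).toReal)
      + (ENNReal.ofReal ((2 - 1) * |f u| - φ 2)
      + (ENNReal.ofReal (φ (F.rnDeriv Fstar u).toReal) + ENNReal.ofReal (φ 2))) := by
    intro u
    have e : ‖(F.rnDeriv Fstar u).toReal • f u‖ₑ = ENNReal.ofReal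
        (((F.rnDeriv Fstar u).toReal - 1) * |f u| - φ (F.rnDeriv Fstar u).toReal
          + ((2 - 1) * |f u| - φ 2 + (φ (F.rnDeriv Fstar u).toReal + φ 2))) := by
      rw [← ofReal_norm, norm_smul, Real.norm_eq_abs, Real.norm_eq_abs,
        abs_of_nonneg ENNReal.toReal_nonneg]
      ring_nf
    rw [e]
    exact ENNReal.ofReal_add_le.trans (add_le_add_right
      (ENNReal.ofReal_add_le.trans (add_le_add_right ENNReal.ofReal_add_le _)) _)
  refine (lintegral_mono hbound).trans_lt ?_
  have hAm : Measurable fun u => ENNReal.ofReal (((F.rnDeriv Fstar u).toReal - 1) * |f u|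
      - φ (F.rnDeriv Fstar u).toReal) :=
    (((hh.sub_const 1).mul hfm.abs).sub hφm).ennreal_ofReal
  rw [lintegral_add_left hAm,
    lintegral_add_left (by fun_prop), lintegral_add_left hφm.ennreal_ofReal, lintegral_const]
  simp only [measure_univ, mul_one]
  exact ENNReal.add_lt_top.2 ⟨hA, ENNReal.add_lt_top.2 ⟨hB, ENNReal.add_lt_top.2
    ⟨hD, ENNReal.ofReal_lt_top⟩⟩⟩

lemma add_smul_mem_NInfty [IsProbabilityMeasure Fstar] (hφ : PhiOne φ) {F G : Measure U}
    (hF : F ∈ NInfty φ Fstar) (hG : G ∈ NInfty φ Fstar) {a b : ℝ} (ha : 0 ≤ a) (hb : 0 ≤ b)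
    (hab : a + b = 1) : ENNReal.ofReal a • F + ENNReal.ofReal b • G ∈ NInfty φ Fstar := by
  obtain ⟨_, hFD⟩ := hF
  obtain ⟨_, hGD⟩ := hG
  have hFac := absolutelyContinuous_of_Dphi_lt_top hFD
  have hGac := absolutelyContinuous_of_Dphi_lt_top hGD
  rw [Dphi, if_pos hFac] at hFD
  rw [Dphi, if_pos hGac] at hGD
  have hac : ENNReal.ofReal a • F + ENNReal.ofReal b • G ≪ Fstar :=
    (hFac.smul_left _).add_left (hGac.smul_left _)
  have hFfin : IsFiniteMeasure (ENNReal.ofReal a • F) := Measure.smul_finite _ ENNReal.ofReal_ne_top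
  have hGfin : IsFiniteMeasure (ENNReal.ofReal b • G) := Measure.smul_finite _ ENNReal.ofReal_ne_top
  refine ⟨⟨by simp [← ENNReal.ofReal_add ha hb, hab]⟩, ?_⟩
  rw [Dphi, if_pos hac]
  have hFm := hφ.measurable_comp (Measure.measurable_rnDeriv F Fstar).ennreal_toReal
    fun u => ENNReal.toReal_nonneg
  have hbound : ∀ᵐ u ∂Fstar, ENNReal.ofReal
      (φ ((ENNReal.ofReal a • F + ENNReal.ofReal b • G).rnDeriv Fstar u).toReal) ≤
      ENNReal.ofReal a * ENNReal.ofReal (φ (F.rnDeriv Fstar u).toReal)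
      + ENNReal.ofReal b * ENNReal.ofReal (φ (G.rnDeriv Fstar u).toReal) := by
    filter_upwards [Measure.rnDeriv_add (ENNReal.ofReal a • F) (ENNReal.ofReal b • G) Fstar,
      Measure.rnDeriv_smul_left_of_ne_top F Fstar (ENNReal.ofReal_ne_top (r := a)),
      Measure.rnDeriv_smul_left_of_ne_top G Fstar (ENNReal.ofReal_ne_top (r := b)),
      F.rnDeriv_ne_top Fstar, G.rnDeriv_ne_top Fstar] with u h1 h2 h3 h4 h5
    have e : ((ENNReal.ofReal a • F + ENNReal.ofReal b • G).rnDeriv Fstar u).toReal =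
        a * (F.rnDeriv Fstar u).toReal + b * (G.rnDeriv Fstar u).toReal := by
      rw [h1, Pi.add_apply, h2, h3, Pi.smul_apply, Pi.smul_apply, smul_eq_mul, smul_eq_mul,
        ENNReal.toReal_add (ENNReal.mul_ne_top ENNReal.ofReal_ne_top h4)
          (ENNReal.mul_ne_top ENNReal.ofReal_ne_top h5), ENNReal.toReal_mul, ENNReal.toReal_mul,
        ENNReal.toReal_ofReal ha, ENNReal.toReal_ofReal hb]
    rw [e, ← ENNReal.ofReal_mul ha, ← ENNReal.ofReal_mul hb]
    refine (ENNReal.ofReal_le_ofReal ?_).trans ENNReal.ofReal_add_le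
    exact hφ.sconvex.convexOn.2 (mem_Ici.2 ENNReal.toReal_nonneg)
      (mem_Ici.2 ENNReal.toReal_nonneg) ha hb hab
  refine (lintegral_mono_ae hbound).trans_lt ?_
  rw [lintegral_add_left (hFm.ennreal_ofReal.const_mul _), lintegral_const_mul' _ _ ENNReal.ofReal_ne_top,
    lintegral_const_mul' _ _ ENNReal.ofReal_ne_top]
  exact ENNReal.add_lt_top.2 ⟨ENNReal.mul_lt_top ENNReal.ofReal_lt_top hFD,
    ENNReal.mul_lt_top ENNReal.ofReal_lt_top hGD⟩

lemma cond_mem_NInfty (φ : ℝ → ℝ) [IsProbabilityMeasure Fstar] {B : Set U} (hB : MeasurableSet B)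
    (hB0 : Fstar B ≠ 0) : ProbabilityTheory.cond Fstar B ∈ NInfty φ Fstar := by
  refine ⟨ProbabilityTheory.cond_isProbabilityMeasure hB0, ?_⟩
  rw [Dphi, if_pos ProbabilityTheory.cond_absolutelyContinuous]
  have hbound : ∀ᵐ u ∂Fstar,
      ENNReal.ofReal (φ ((ProbabilityTheory.cond Fstar B).rnDeriv Fstar u).toReal) ≤
      ENNReal.ofReal (φ (Fstar B)⁻¹.toReal) + ENNReal.ofReal (φ 0) := by
    filter_upwards [Measure.rnDeriv_smul_left_of_ne_top (Fstar.restrict B) Fstar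
      (ENNReal.inv_ne_top.2 hB0), Measure.rnDeriv_restrict_self Fstar hB] with u h1 h2
    rw [ProbabilityTheory.cond, h1, Pi.smul_apply, h2]
    by_cases hu : u ∈ B
    · simp [hu]
    · simp [hu]
  refine (lintegral_mono_ae hbound).trans_lt ?_
  simp [lintegral_const]

/-- A lower bound on all expectations over `N_∞` is an `F*`-almost sure lower bound. -/
lemma ae_le_of_forall_NInfty_le_integral [IsProbabilityMeasure Fstar] {X : U → ℝ}
    (hX : Measurable X) (hint : ∀ F ∈ NInfty φ Fstar, Integrable X F) {c : ℝ}
    (hc : ∀ F ∈ NInfty φ Fstar, c ≤ ∫ u, X u ∂F) : ∀ᵐ u ∂Fstar, c ≤ X u := by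
  by_contra hne
  have hB : MeasurableSet {u | X u < c} := measurableSet_lt hX measurable_const
  have hB0 : Fstar {u | X u < c} ≠ 0 := by simpa [ae_iff] using hne
  have hF := cond_mem_NInfty φ hB hB0
  set F := ProbabilityTheory.cond Fstar {u | X u < c}
  have := hF.1
  have hlt : ∀ᵐ u ∂F, X u < c := ProbabilityTheory.ae_cond_mem hB
  have hsub : Integrable (fun u => c - X u) F := (integrable_const c).sub (hint F hF)
  have h0 : ∫ u, (c - X u) ∂F = 0 := by
    refine le_antisymm ?_ (integral_nonneg_of_ae ?_)
    · rw [integral_sub (f := fun _ => c) (integrable_const _) (hint F hF)]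
      simpa using hc F hF
    · filter_upwards [hlt] with u hu using by simpa using hu.le
  rw [integral_eq_zero_iff_of_nonneg_ae
    (by filter_upwards [hlt] with u hu using by simpa using hu.le) hsub] at h0
  have hfalse : ∀ᵐ u ∂F, False := by
    filter_upwards [hlt, h0] with u h1 h2
    simp only [Pi.zero_apply] at h2
    linarith
  exact (NeZero.ne F) (by simpa using hfalse)

end Divergence

section Duality

variable {U : Type*} [MeasurableSpace U] {dθ d1 d2 d3 d4 : ℕ} {Γ : Type*}
  {φ : ℝ → ℝ} {Fstar : Measure U} {g : U → (Fin dθ → ℝ) → Γ → Vec4 d1 d2 d3 d4}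
  {θ : Fin dθ → ℝ} {γ : Γ} {P : Vec12 d1 d2} {F G : Measure U}

/-- The vector of expectations `E^F[g(U,θ,γ)]`. -/
def momentVec (g : U → (Fin dθ → ℝ) → Γ → Vec4 d1 d2 d3 d4) (θ : Fin dθ → ℝ) (γ : Γ)
    (F : Measure U) : Vec4 d1 d2 d3 d4 :=
  ((fun i => ∫ u, (g u θ γ).1 i ∂F), (fun i => ∫ u, (g u θ γ).2.1 i ∂F),
    (fun i => ∫ u, (g u θ γ).2.2.1 i ∂F), (fun i => ∫ u, (g u θ γ).2.2.2 i ∂F))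

lemma integrable_dot {ι : Type*} [Fintype ι] {h : U → ι → ℝ}
    (hint : ∀ i, Integrable (fun u => h u i) F) (a : ι → ℝ) :
    Integrable (fun u => dot a (h u)) F :=
  integrable_finsetSum _ fun i _ => (hint i).const_mul _

lemma integral_dot {ι : Type*} [Fintype ι] {h : U → ι → ℝ}
    (hint : ∀ i, Integrable (fun u => h u i) F) (a : ι → ℝ) :
    ∫ u, dot a (h u) ∂F = dot a fun i => ∫ u, h u i ∂F := by
  simp only [dot]
  rw [integral_finsetSum _ fun i _ => (hint i).const_mul _]
  simp only [integral_const_mul]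

lemma GIntegrable.dot4 (h : GIntegrable g θ γ F) (l : Vec4 d1 d2 d3 d4) :
    Integrable (fun u => dot4 l (g u θ γ)) F :=
  (((integrable_dot h.1 _).fun_add (integrable_dot h.2.1 _)).fun_add
    (integrable_dot h.2.2.1 _)).fun_add (integrable_dot h.2.2.2 _)

lemma integral_dot4 (h : GIntegrable g θ γ F) (l : Vec4 d1 d2 d3 d4) :
    ∫ u, dot4 l (g u θ γ) ∂F = dot4 l (momentVec g θ γ F) := by
  have i1 := integrable_dot h.1 l.1
  have i2 := integrable_dot h.2.1 l.2.1
  have i3 := integrable_dot h.2.2.1 l.2.2.1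
  have i4 := integrable_dot h.2.2.2 l.2.2.2
  simp only [CFSens.dot4, momentVec]
  rw [integral_add ((i1.fun_add i2).fun_add i3) i4, integral_add (i1.fun_add i2) i3,
    integral_add i1 i2, integral_dot h.1, integral_dot h.2.1, integral_dot h.2.2.1,
    integral_dot h.2.2.2]

lemma integral_add_smul {f : U → ℝ} (hF : Integrable f F) (hG : Integrable f G) {a b : ℝ}
    (ha : 0 ≤ a) (hb : 0 ≤ b) :
    ∫ u, f u ∂(ENNReal.ofReal a • F + ENNReal.ofReal b • G) =
      a * ∫ u, f u ∂F + b * ∫ u, f u ∂G := by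
  rw [integral_add_measure (hF.smul_measure ENNReal.ofReal_ne_top)
    (hG.smul_measure ENNReal.ofReal_ne_top), integral_smul_measure, integral_smul_measure,
    ENNReal.toReal_ofReal ha, ENNReal.toReal_ofReal hb, smul_eq_mul, smul_eq_mul]

lemma momentVec_add_smul (hF : GIntegrable g θ γ F) (hG : GIntegrable g θ γ G) {a b : ℝ}
    (ha : 0 ≤ a) (hb : 0 ≤ b) :
    momentVec g θ γ (ENNReal.ofReal a • F + ENNReal.ofReal b • G) =
      a • momentVec g θ γ F + b • momentVec g θ γ G := by
  obtain ⟨h1, h2, h3, h4⟩ := hF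
  obtain ⟨h1', h2', h3', h4'⟩ := hG
  refine Prod.ext (funext fun i => ?_) (Prod.ext (funext fun i => ?_)
    (Prod.ext (funext fun i => ?_) (funext fun i => ?_)))
  · exact integral_add_smul (h1 i) (h1' i) ha hb
  · exact integral_add_smul (h2 i) (h2' i) ha hb
  · exact integral_add_smul (h3 i) (h3' i) ha hb
  · exact integral_add_smul (h4 i) (h4' i) ha hb

lemma constraintsHold_of_eq_momentVec_add (hF : GIntegrable g θ γ F) {c : Vec4 d1 d2 d3 d4}
    (hc : c ∈ (coneC : Set (Vec4 d1 d2 d3 d4)))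
    (h : ((P.1, P.2, 0, 0) : Vec4 d1 d2 d3 d4) = momentVec g θ γ F + c) :
    ConstraintsHold g θ γ P F := by
  obtain ⟨c1, c2, c3, c4⟩ := hc
  have e1 := congrArg Prod.fst h
  have e2 := congrArg (fun x => x.2.1) h
  have e3 := congrArg (fun x => x.2.2.1) h
  have e4 := congrArg (fun x => x.2.2.2) h
  simp only [Prod.fst_add, Prod.snd_add, c2, c4, add_zero, momentVec] at e1 e2 e3 e4
  refine ⟨hF, fun i => ?_, fun i => ?_, fun i => ?_, fun i => ?_⟩
  · have := congrFun e1 i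
    simp only [Pi.add_apply] at this
    linarith [c1 i]
  · exact (congrFun e2 i).symm
  · have := congrFun e3 i
    simp only [Pi.add_apply, Pi.zero_apply] at this
    linarith [c3 i]
  · exact (congrFun e4 i).symm

lemma dot4_momentVec_le_dotP (hC : ConstraintsHold g θ γ P F) {l : Vec4 d1 d2 d3 d4}
    (hl : inLambda l) : dot4 l (momentVec g θ γ F) ≤ dotP l P := by
  obtain ⟨-, h1, h2, h3, h4⟩ := hC
  have e2 : (momentVec g θ γ F).2.1 = P.2 := funext h2
  have e4 : (momentVec g θ γ F).2.2.2 = 0 := funext h4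
  have i1 : dot l.1 (momentVec g θ γ F).1 ≤ dot l.1 P.1 := dot_le_dot_of_nonneg_left hl.1 h1
  have i3 : dot l.2.2.1 (momentVec g θ γ F).2.2.1 ≤ dot l.2.2.1 0 :=
    dot_le_dot_of_nonneg_left hl.2 h3
  rw [dot_zero] at i3
  rw [dot4, dotP, e2, e4, dot_zero]
  linarith

/-- Weak duality for a single feasible distribution and a single multiplier. -/
lemma sub_dotP_le_integral {K : U → ℝ} (hF : F ∈ NInfty φ Fstar)
    (hC : ConstraintsHold g θ γ P F) (hK : Integrable K F) {l : Vec4 d1 d2 d3 d4}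
    (hl : inLambda l) {m : ℝ} (hm : ∀ᵐ u ∂Fstar, m ≤ K u + dot4 l (g u θ γ)) :
    m - dotP l P ≤ ∫ u, K u ∂F := by
  obtain ⟨_, hD⟩ := hF
  have hmF := (absolutelyContinuous_of_Dphi_lt_top hD).ae_le hm
  have h1 : ∫ _, m ∂F ≤ ∫ u, (K u + dot4 l (g u θ γ)) ∂F :=
    integral_mono_ae (integrable_const _) (hK.add (hC.1.dot4 l)) hmF
  rw [integral_add hK (hC.1.dot4 l), integral_dot4 hC.1] at h1
  simp only [integral_const, probReal_univ, one_smul] at h1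
  linarith [dot4_momentVec_le_dotP hC hl]

/-- Under Condition S, every lower bound of the primal program is attained by a multiplier. -/
lemma exists_multiplier_of_conditionS [IsProbabilityMeasure Fstar] (hφ : PhiOne φ) {K : U → ℝ}
    (hKm : Measurable K) (hgm : ∀ l, Measurable fun u => dot4 l (g u θ γ))
    (hK : ∀ F ∈ NInfty φ Fstar, Integrable K F)
    (hg : ∀ F ∈ NInfty φ Fstar, GIntegrable g θ γ F) (hS : ConditionS φ Fstar g θ γ P) {v : ℝ}
    (hv : ∀ F ∈ NInfty φ Fstar, ConstraintsHold g θ γ P F → v ≤ ∫ u, K u ∂F) :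
    ∃ l : Vec4 d1 d2 d3 d4, inLambda l ∧
      ∀ᵐ u ∂Fstar, v + dotP l P ≤ K u + dot4 l (g u θ γ) := by
  set A : Set (Vec4 d1 d2 d3 d4 × ℝ) := {x | ∃ F ∈ NInfty φ Fstar,
    ∃ c ∈ (coneC : Set (Vec4 d1 d2 d3 d4)),
      x.1 = momentVec g θ γ F + c ∧ ∫ u, K u ∂F ≤ x.2}
  have hA : Convex ℝ A := by
    rintro ⟨y, r⟩ ⟨F, hF, c, hc, hy, hr⟩ ⟨y', r'⟩ ⟨F', hF', c', hc', hy', hr'⟩ a b ha hb hab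
    refine ⟨_, add_smul_mem_NInfty hφ hF hF' ha hb hab, a • c + b • c',
      add_mem_coneC (smul_mem_coneC hc ha) (smul_mem_coneC hc' hb), ?_, ?_⟩
    · simp only at hy hy'
      rw [momentVec_add_smul (hg F hF) (hg F' hF') ha hb]
      simp only [Prod.smul_mk, Prod.mk_add_mk, hy, hy', smul_add]
      abel
    · rw [integral_add_smul (hK F hF) (hK F' hF') ha hb]
      exact add_le_add (mul_le_mul_of_nonneg_left hr ha) (mul_le_mul_of_nonneg_left hr' hb)
  have hup : ∀ y r s, (y, r) ∈ A → r ≤ s → (y, s) ∈ A := by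
    rintro y r s ⟨F, hF, c, hc, hy, hr⟩ hrs
    exact ⟨F, hF, c, hc, hy, hr.trans hrs⟩
  have hp : ((P.1, P.2, 0, 0) : Vec4 d1 d2 d3 d4) ∈ interior (Prod.fst '' A) := by
    refine interior_mono ?_ hS
    rintro _ ⟨_, ⟨F, hFp, hFD, -, rfl⟩, c, hc, rfl⟩
    exact ⟨(momentVec g θ γ F + c, ∫ u, K u ∂F), ⟨F, ⟨hFp, hFD⟩, c, hc, rfl, le_rfl⟩, rfl⟩
  have hvA : ∀ r, (((P.1, P.2, 0, 0) : Vec4 d1 d2 d3 d4), r) ∈ A → v ≤ r := by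
    rintro r ⟨F, hF, c, hc, hy, hr⟩
    exact (hv F hF (constraintsHold_of_eq_momentVec_add (hg F hF) hc hy)).trans hr
  obtain ⟨f, hf⟩ := exists_supporting_functional hA hup hp hvA
  obtain ⟨l, hl⟩ := exists_eq_dot4 f
  have hfP : f (P.1, P.2, 0, 0) = dotP l P := by
    rw [hl, dot4, dotP, dot_zero, dot_zero, add_zero, add_zero]
  have hsup : ∀ F ∈ NInfty φ Fstar, ∀ c ∈ (coneC : Set (Vec4 d1 d2 d3 d4)),
      v + dotP l P ≤ ∫ u, K u ∂F + (dot4 l (momentVec g θ γ F) + dot4 l c) := by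
    intro F hF c hc
    have := hf _ _ ⟨F, hF, c, hc, rfl, le_rfl⟩
    rwa [hfP, hl, dot4_add] at this
  refine ⟨l, inLambda_of_nonneg_on_coneC fun c hc => ?_,
    ae_le_of_forall_NInfty_le_integral (φ := φ) (hKm.add (hgm l))
      (fun F hF => (hK F hF).add ((hg F hF).dot4 l)) fun F hF => ?_⟩
  · obtain ⟨⟨_, r⟩, ⟨F, hF, -⟩, -⟩ := interior_subset hp
    by_contra! hneg
    obtain ⟨t, ht⟩ := exists_nat_gt ((∫ u, K u ∂F + dot4 l (momentVec g θ γ F)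
      - (v + dotP l P)) / (-dot4 l c))
    have h1 := hsup F hF ((t : ℝ) • c) (smul_mem_coneC hc t.cast_nonneg)
    rw [← hl (_ • c), map_smul, hl, smul_eq_mul] at h1
    rw [div_lt_iff₀ (neg_pos.2 hneg)] at ht
    linarith
  · have h1 := hsup F hF 0 zero_mem_coneC
    rw [integral_add' (hK F hF) ((hg F hF).dot4 l), integral_dot4 (hg F hF)]
    rw [← hl 0, map_zero, add_zero] at h1
    exact h1

variable {k : U → (Fin dθ → ℝ) → Γ → ℝ}

lemma PhiTwo.gIntegrable [IsProbabilityMeasure Fstar] (hφ : PhiOne φ)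
    (h : PhiTwo φ Fstar g k) (hF : F ∈ NInfty φ Fstar) : GIntegrable g θ γ F :=
  have ⟨_, h1, h2, h3, h4⟩ := h θ γ
  ⟨fun i => (h1 i).integrable hφ hF, fun i => (h2 i).integrable hφ hF,
    fun i => (h3 i).integrable hφ hF, fun i => (h4 i).integrable hφ hF⟩

lemma PhiTwo.measurable_dot4 (h : PhiTwo φ Fstar g k) (l : Vec4 d1 d2 d3 d4) :
    Measurable fun u => dot4 l (g u θ γ) := by
  obtain ⟨_, h1, h2, h3, h4⟩ := h θ γ
  unfold dot4 dot
  exact (((Finset.measurable_sum _ fun i _ => (h1 i).1.const_mul _).add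
    (Finset.measurable_sum _ fun i _ => (h2 i).1.const_mul _)).add
    (Finset.measurable_sum _ fun i _ => (h3 i).1.const_mul _)).add
    (Finset.measurable_sum _ fun i _ => (h4 i).1.const_mul _)

variable [IsProbabilityMeasure Fstar]

lemma kappaLowInftyDual_le :
    kappaLowInftyDual Fstar g k θ γ P ≤ kappaLowInfty φ Fstar g k θ γ P := by
  refine sSup_le ?_
  rintro _ ⟨l, hl, hbot, rfl⟩
  refine le_sInf ?_
  rintro _ ⟨F, hFp, hFD, hC, hK, rfl⟩
  have hae := ae_essInf_le (μ := Fstar)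
    (f := fun u => ((k u θ γ + dot4 l (g u θ γ) : ℝ) : EReal))
  obtain ⟨u₀, hu₀⟩ := hae.exists
  generalize essInf (fun u => ((k u θ γ + dot4 l (g u θ γ) : ℝ) : EReal)) Fstar = m at *
  lift m to ℝ using ⟨ne_top_of_le_ne_top (EReal.coe_ne_top _) hu₀, hbot⟩
  exact_mod_cast sub_dotP_le_integral ⟨hFp, hFD⟩ hC hK hl
    (by filter_upwards [hae] with u hu using by exact_mod_cast hu)

lemma le_kappaHighInftyDual :
    kappaHighInfty φ Fstar g k θ γ P ≤ kappaHighInftyDual Fstar g k θ γ P := by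
  refine le_sInf ?_
  rintro _ ⟨l, hl, htop, rfl⟩
  refine sSup_le ?_
  rintro _ ⟨F, hFp, hFD, hC, hK, rfl⟩
  have hae := ae_le_essSup (μ := Fstar)
    (f := fun u => ((k u θ γ - dot4 l (g u θ γ) : ℝ) : EReal))
  obtain ⟨u₀, hu₀⟩ := hae.exists
  generalize essSup (fun u => ((k u θ γ - dot4 l (g u θ γ) : ℝ) : EReal)) Fstar = m at *
  lift m to ℝ using ⟨htop, ne_bot_of_le_ne_bot (EReal.coe_ne_bot _) hu₀⟩
  have h1 := sub_dotP_le_integral (m := -m) ⟨hFp, hFD⟩ hC hK.neg hl (by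
    filter_upwards [hae] with u hu
    have hu' : k u θ γ - dot4 l (g u θ γ) ≤ m := by exact_mod_cast hu
    simp only [Pi.neg_apply]
    linarith)
  simp only [Pi.neg_apply, integral_neg] at h1
  have h2 : ∫ u, k u θ γ ∂F ≤ m + dotP l P := by linarith
  exact_mod_cast h2

lemma kappaLowInfty_le_dual (hφ : PhiOne φ) (h : PhiTwo φ Fstar g k)
    (hS : ConditionS φ Fstar g θ γ P) :
    kappaLowInfty φ Fstar g k θ γ P ≤ kappaLowInftyDual Fstar g k θ γ P := by
  refine le_of_forall_lt fun x hx => ?_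
  obtain ⟨v, hxv, hv⟩ := EReal.lt_iff_exists_real_btwn.1 hx
  have hK : ∀ F ∈ NInfty φ Fstar, Integrable (fun u => k u θ γ) F :=
    fun F hF => (h θ γ).1.integrable hφ hF
  obtain ⟨l, hl, hae⟩ := exists_multiplier_of_conditionS hφ (h θ γ).1.1 h.measurable_dot4 hK
    (fun F hF => h.gIntegrable hφ hF) hS (v := v) fun F hF hC => by
      have : kappaLowInfty φ Fstar g k θ γ P ≤ ((∫ u, k u θ γ ∂F : ℝ) : EReal) :=
        sInf_le ⟨F, hF.1, hF.2, hC, hK F hF, rfl⟩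
      exact_mod_cast hv.le.trans this
  have hess : ((v + dotP l P : ℝ) : EReal) ≤
      essInf (fun u => ((k u θ γ + dot4 l (g u θ γ) : ℝ) : EReal)) Fstar :=
    le_essInf_of_ae_le _ (by filter_upwards [hae] with u hu using by exact_mod_cast hu)
  refine hxv.trans_le (le_trans ?_ (le_sSup
    ⟨l, hl, ne_bot_of_le_ne_bot (EReal.coe_ne_bot _) hess, rfl⟩))
  refine le_trans (le_of_eq ?_) (EReal.sub_le_sub hess le_rfl)
  rw [← EReal.coe_sub, add_sub_cancel_right]

lemma dual_le_kappaHighInfty (hφ : PhiOne φ) (h : PhiTwo φ Fstar g k)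
    (hS : ConditionS φ Fstar g θ γ P) :
    kappaHighInftyDual Fstar g k θ γ P ≤ kappaHighInfty φ Fstar g k θ γ P := by
  refine le_of_forall_gt fun x hx => ?_
  obtain ⟨v, hv, hvx⟩ := EReal.lt_iff_exists_real_btwn.1 hx
  have hK : ∀ F ∈ NInfty φ Fstar, Integrable (fun u => k u θ γ) F :=
    fun F hF => (h θ γ).1.integrable hφ hF
  obtain ⟨l, hl, hae⟩ := exists_multiplier_of_conditionS hφ (h θ γ).1.1.neg h.measurable_dot4
    (fun F hF => (hK F hF).neg) (fun F hF => h.gIntegrable hφ hF) hS (v := -v) fun F hF hC => by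
      have h1 : ((∫ u, k u θ γ ∂F : ℝ) : EReal) ≤ kappaHighInfty φ Fstar g k θ γ P :=
        le_sSup ⟨F, hF.1, hF.2, hC, hK F hF, rfl⟩
      have h2 : ∫ u, k u θ γ ∂F ≤ v := by exact_mod_cast h1.trans hv.le
      simpa [integral_neg] using h2
  have hess : essSup (fun u => ((k u θ γ - dot4 l (g u θ γ) : ℝ) : EReal)) Fstar ≤
      ((v - dotP l P : ℝ) : EReal) := by
    refine essSup_le_of_ae_le _ ?_
    filter_upwards [hae] with u hu
    simp only [Pi.neg_apply] at hu
    exact EReal.coe_le_coe_iff.2 (by linarith)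
  refine lt_of_le_of_lt (le_trans (sInf_le
    ⟨l, hl, ne_top_of_le_ne_top (EReal.coe_ne_top _) hess, rfl⟩) ?_) hvx
  refine (add_le_add_left hess _).trans (le_of_eq ?_)
  rw [← EReal.coe_add, sub_add_cancel]

end Duality

end CFSens

/-- **Appendix Lemma: conic duality over the full divergence class `N_∞`.**
Under Assumptions Φ(i) and Φ(ii), weak duality `κ̲*_∞ ≤ κ̲_∞` and `κ̄_∞ ≤ κ̄*_∞` holds at
every `(θ,γ,P)`; if Condition S holds at `(θ,γ,P)` then strong duality holds. -/
theorem conic_duality_over_Ninfty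
    {U : Type*} [MeasurableSpace U] {dθ d1 d2 d3 d4 : ℕ} {Γ : Type*}
    (φ : ℝ → ℝ) (Fstar : Measure U) [IsProbabilityMeasure Fstar]
    (g : U → (Fin dθ → ℝ) → Γ → Vec4 d1 d2 d3 d4)
    (k : U → (Fin dθ → ℝ) → Γ → ℝ)
    (hΦ1 : PhiOne φ)
    (hΦ2 : PhiTwo φ Fstar g k) :
    ∀ (θ : Fin dθ → ℝ) (γ : Γ) (P : Vec12 d1 d2),
      (kappaLowInftyDual Fstar g k θ γ P ≤ kappaLowInfty φ Fstar g k θ γ P ∧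
       kappaHighInfty φ Fstar g k θ γ P ≤ kappaHighInftyDual Fstar g k θ γ P) ∧
      (ConditionS φ Fstar g θ γ P →
        kappaLowInfty φ Fstar g k θ γ P = kappaLowInftyDual Fstar g k θ γ P ∧
        kappaHighInfty φ Fstar g k θ γ P = kappaHighInftyDual Fstar g k θ γ P) := by
  intro θ γ P
  exact ⟨⟨kappaLowInftyDual_le, le_kappaHighInftyDual⟩, fun hS =>
    ⟨(kappaLowInfty_le_dual hΦ1 hΦ2 hS).antisymm kappaLowInftyDual_le,
      le_kappaHighInftyDual.antisymm (dual_le_kappaHighInfty hΦ1 hΦ2 hS)⟩⟩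
end
end
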